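/- There exists c₃∈(0,+∞) such that for each ε∈(0,1), all g₀,g₁,g₂∈Γ_ε and all w∈W_*: ρ_Γ(ℋ_Γ(g₁M_w)^{1/d}·g₁M_w, ℋ_Γ(g₂M_w)^{1/d}·g₂M_w) ≤ c₃·ε^{−45d}·ℋ_Γ(g₀M_w/‖M_w‖)^{1/d}·ρ_Γ(g₁,g₂), where ‖M_w‖ denotes the operator norm of M_w with respect to the Euclidean norm on ℝ⁴. -/

import Mathlib

open MeasureTheory Filter Topology Matrix
open scoped ENNReal NNReal BigOperators

noncomputable section

/-- `D` is an open (round) disk in `ℂ`. -/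
def IsOpenDisk (D : Set ℂ) : Prop := ∃ z : ℂ, ∃ r : ℝ, 0 < r ∧ D = Metric.ball z r

/-- `D` is an open half-plane in `ℂ`. -/
def IsOpenHalfPlane (D : Set ℂ) : Prop :=
  ∃ a : ℂ, a ≠ 0 ∧ ∃ c : ℝ, D = {z : ℂ | (a * z).re < c}

/-- The center of an open disk (junk value otherwise). -/
noncomputable def diskCenter (D : Set ℂ) : ℂ :=
  Classical.epsilon fun z : ℂ => ∃ r : ℝ, 0 < r ∧ D = Metric.ball z r

/-- The radius of an open disk (junk value otherwise). -/
noncomputable def diskRadius (D : Set ℂ) : ℝ :=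
  Classical.epsilon fun r : ℝ => 0 < r ∧ ∃ z : ℂ, D = Metric.ball z r

/-- The curvature of `D`: the reciprocal of the radius for an open disk,
and `0` for a half-plane (or anything that is not an open disk). -/
noncomputable def curv (D : Set ℂ) : ℝ :=
  haveI := Classical.propDecidable (IsOpenDisk D)
  if IsOpenDisk D then (diskRadius D)⁻¹ else 0

/-- A tangential disk triple: each member is an open disk or an open half-plane
(at most one half-plane), and the closures of distinct members meet in exactly one point. -/
def IsTDT (𝒟 : Fin 3 → Set ℂ) : Prop :=
  ((∀ j, IsOpenDisk (𝒟 j)) ∨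
    (∃ j, IsOpenHalfPlane (𝒟 j) ∧ ∀ k, k ≠ j → IsOpenDisk (𝒟 k))) ∧
  ∀ j k, j ≠ k → ∃ p : ℂ, closure (𝒟 j) ∩ closure (𝒟 k) = {p}

/-- The ideal triangle `T(𝒟)`: the unique bounded connected component of
`ℂ ∖ (closure D₁ ∪ closure D₂ ∪ closure D₃)`. -/
noncomputable def idealTriangle (𝒟 : Fin 3 → Set ℂ) : Set ℂ :=
  Classical.epsilon fun T : Set ℂ =>
    Bornology.IsBounded T ∧
    ∃ z ∈ (⋃ j, closure (𝒟 j))ᶜ, T = connectedComponentIn (⋃ j, closure (𝒟 j))ᶜ z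

/-- `q_j(𝒟)`: the tangency point of the two members other than the `j`-th one. -/
noncomputable def tangencyPoint (𝒟 : Fin 3 → Set ℂ) (j : Fin 3) : ℂ :=
  Classical.epsilon fun p : ℂ => closure (𝒟 (j + 1)) ∩ closure (𝒟 (j + 2)) = {p}

/-- `𝒟` is a positively oriented tangential disk triple: the tangency points
`q₁(𝒟), q₂(𝒟), q₃(𝒟)` occur in counterclockwise order, i.e. the ideal triangle
lies to the left of its boundary oriented through `q₁(𝒟), q₂(𝒟), q₃(𝒟)` in this order. -/
def IsTDTplus (𝒟 : Fin 3 → Set ℂ) : Prop :=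
  IsTDT 𝒟 ∧
  0 < ((tangencyPoint 𝒟 1 - tangencyPoint 𝒟 0).re *
        (tangencyPoint 𝒟 2 - tangencyPoint 𝒟 0).im -
       (tangencyPoint 𝒟 1 - tangencyPoint 𝒟 0).im *
        (tangencyPoint 𝒟 2 - tangencyPoint 𝒟 0).re)

/-- `D` is an inscribed disk of the ideal triangle of `𝒟`. -/
def IsInscribedDisk (𝒟 : Fin 3 → Set ℂ) (D : Set ℂ) : Prop :=
  IsOpenDisk D ∧ D ⊆ idealTriangle 𝒟 ∧ ∀ j, ∃ p : ℂ, closure D ∩ closure (𝒟 j) = {p}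

/-- The inscribed disk `D_in(𝒟)` of the ideal triangle of `𝒟`. -/
noncomputable def Din (𝒟 : Fin 3 → Set ℂ) : Set ℂ := Classical.epsilon (IsInscribedDisk 𝒟)

/-- `Φ_j(𝒟)`: replace the `j`-th entry of `𝒟` by the inscribed disk `D_in(𝒟)`. -/
noncomputable def Phi (j : Fin 3) (𝒟 : Fin 3 → Set ℂ) : Fin 3 → Set ℂ :=
  Function.update 𝒟 j (Din 𝒟)

/-- Finite words over the alphabet `{1,2,3}` (represented by `Fin 3`). -/
abbrev Word := List (Fin 3)

/-- `𝒟_w = Φ_w(𝒟) = (Φ_{w_m} ∘ ⋯ ∘ Φ_{w_1})(𝒟)`. -/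
noncomputable def applyWord (𝒟 : Fin 3 → Set ℂ) (w : Word) : Fin 3 → Set ℂ :=
  w.foldl (fun D j => Phi j D) 𝒟

/-- The Apollonian gasket `K(𝒟)` associated with `𝒟`. -/
noncomputable def AG (𝒟 : Fin 3 → Set ℂ) : Set ℂ :=
  closure (idealTriangle 𝒟) \ ⋃ w : Word, Din (applyWord 𝒟 w)

/-- A concrete positively oriented tangential disk triple. -/
noncomputable def baseTriple : Fin 3 → Set ℂ :=
  ![{z : ℂ | 1 < z.im},
    Metric.ball (Complex.I / 2 - 1 / 2) (1 / 2),
    Metric.ball (Complex.I / 2 + 1 / 2) (1 / 2)]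

/-- `d`, the Hausdorff dimension of the Apollonian gasket
(independent of the choice of `𝒟 ∈ TDT⁺`). -/
noncomputable def dAG : ℝ := (dimH (AG baseTriple)).toReal

/-- The matrices `M₁, M₂, M₃`. -/
def Mmat : Fin 3 → Matrix (Fin 4) (Fin 4) ℝ :=
  ![!![1,0,0,0; 1,1,0,1; 1,0,1,1; 2,0,0,1],
    !![1,1,0,1; 0,1,0,0; 0,1,1,1; 0,2,0,1],
    !![1,0,1,1; 0,1,1,1; 0,0,1,0; 0,0,2,1]]

/-- `M_w := M_{w₁} ⋯ M_{w_m}` (`M_∅` is the identity matrix). -/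
def Mword (w : Word) : Matrix (Fin 4) (Fin 4) ℝ := (w.map Mmat).prod

/-- `κ(α,β,γ) := √(βγ + γα + αβ)`. -/
noncomputable def kappa (α β γ : ℝ) : ℝ := Real.sqrt (β * γ + γ * α + α * β)

/-- The row vector `(curv D₁, curv D₂, curv D₃, κ(𝒟))`. -/
noncomputable def curvVec (𝒟 : Fin 3 → Set ℂ) : Fin 4 → ℝ :=
  ![curv (𝒟 0), curv (𝒟 1), curv (𝒟 2),
    kappa (curv (𝒟 0)) (curv (𝒟 1)) (curv (𝒟 2))]

/-- The parameter space `Γ = {(g, κ(g)) : g ∈ [0,∞)³, κ(g) > 0} ⊆ [0,∞)⁴`. -/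
def Gamma : Set (Fin 4 → ℝ) :=
  {g | 0 ≤ g 0 ∧ 0 ≤ g 1 ∧ 0 ≤ g 2 ∧ g 3 = kappa (g 0) (g 1) (g 2) ∧ 0 < g 3}

/-- `Γ° := Γ ∩ (0,∞)⁴`. -/
def GammaInt : Set (Fin 4 → ℝ) := {g | g ∈ Gamma ∧ ∀ i, 0 < g i}

/-- The compact subset `Γ_ε` of `Γ`. -/
def GammaEps (ε : ℝ) : Set (Fin 4 → ℝ) :=
  {g | g 0 ∈ Set.Icc 0 ε⁻¹ ∧ g 1 ∈ Set.Icc 0 ε⁻¹ ∧ g 2 ∈ Set.Icc 0 ε⁻¹ ∧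
       g 3 = kappa (g 0) (g 1) (g 2) ∧
       ε ≤ g 1 + g 2 ∧ ε ≤ g 2 + g 0 ∧ ε ≤ g 0 + g 1}

/-- The Euclidean norm on `ℝ⁴`. -/
noncomputable def euclNorm4 (g : Fin 4 → ℝ) : ℝ := Real.sqrt (∑ i, g i ^ 2)

/-- The metric `ρ_Γ` on `Γ`: the Euclidean distance of the first three coordinates. -/
noncomputable def rhoGamma (g₁ g₂ : Fin 4 → ℝ) : ℝ :=
  Real.sqrt ((g₁ 0 - g₂ 0) ^ 2 + (g₁ 1 - g₂ 1) ^ 2 + (g₁ 2 - g₂ 2) ^ 2)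

/-- A positively oriented tangential disk triple with prescribed curvatures
`(g 0, g 1, g 2)` (junk value if none exists). -/
noncomputable def tripleOf (g : Fin 4 → ℝ) : Fin 3 → Set ℂ :=
  Classical.epsilon fun 𝒟 : Fin 3 → Set ℂ =>
    IsTDTplus 𝒟 ∧ curv (𝒟 0) = g 0 ∧ curv (𝒟 1) = g 1 ∧ curv (𝒟 2) = g 2

/-- `ℋ_Γ(g)`: the `d`-dimensional Hausdorff measure of the Apollonian gasket `K(𝒟)`
for any `𝒟 ∈ TDT⁺` whose members have curvatures `(g 0, g 1, g 2)`. -/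
noncomputable def HGamma (g : Fin 4 → ℝ) : ℝ :=
  (μH[dAG] (AG (tripleOf g))).toReal

/-- The operator norm of a `4 × 4` real matrix with respect to the Euclidean norm on `ℝ⁴`. -/
noncomputable def opNorm4 (M : Matrix (Fin 4) (Fin 4) ℝ) : ℝ :=
  sSup {t : ℝ | ∃ v : Fin 4 → ℝ, euclNorm4 v ≤ 1 ∧ t = euclNorm4 (M.mulVec v)}

/-- The set of words `I = {jⁿk : j,k ∈ S, j ≠ k, n ∈ ℕ}`. -/
def IdxI : Set Word :=
  {w | ∃ j k : Fin 3, j ≠ k ∧ ∃ n : ℕ, 0 < n ∧ w = List.replicate n j ++ [k]}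

end

/-- The quadratic polynomial `k|w|² - 2⟨b, w⟩ + m` on `ℂ` attached to `V = (k, b, m)`. -/
noncomputable def quadForm (V : Fin 4 → ℝ) (w : ℂ) : ℝ :=
  V 0 * (w.re ^ 2 + w.im ^ 2) - 2 * (V 1 * w.re + V 2 * w.im) + V 3

/-- The Lorentz inner product of the vectors representing generalized disks. -/
noncomputable def lorentz (V W : Fin 4 → ℝ) : ℝ :=
  V 1 * W 1 + V 2 * W 2 - (V 0 * W 3 + V 3 * W 0) / 2

/-- The generalized open disk represented by `V`. -/
def genDisk (V : Fin 4 → ℝ) : Set ℂ := {w | quadForm V w < 0}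

lemma lorentz_comm (V W : Fin 4 → ℝ) : lorentz V W = lorentz W V := by
  unfold lorentz; ring

lemma continuous_quadForm (V : Fin 4 → ℝ) : Continuous (quadForm V) := by
  unfold quadForm; fun_prop

lemma isOpen_genDisk (V : Fin 4 → ℝ) : IsOpen (genDisk V) :=
  isOpen_lt (continuous_quadForm V) continuous_const

lemma quadForm_line (V : Fin 4 → ℝ) (w d : ℂ) (t : ℝ) :
    quadForm V (w + t * d) = quadForm V w
      - 2 * t * ((V 1 - V 0 * w.re) * d.re + (V 2 - V 0 * w.im) * d.im)
      + t ^ 2 * (V 0 * (d.re ^ 2 + d.im ^ 2)) := by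
  simp [quadForm]; ring

lemma normal_sq {V : Fin 4 → ℝ} (hV : lorentz V V = 1) (w : ℂ) :
    (V 1 - V 0 * w.re) ^ 2 + (V 2 - V 0 * w.im) ^ 2 = 1 + V 0 * quadForm V w := by
  rw [← hV]; unfold lorentz quadForm; ring

/-- A polynomial `-2 t a + t² b` with `a > 0` is negative for small `t > 0`. -/
lemma eventually_neg_of_linear_neg {a : ℝ} (ha : 0 < a) (b : ℝ) :
    ∀ᶠ t : ℝ in 𝓝[>] 0, -2 * t * a + t ^ 2 * b < 0 := by
  have h : ∀ᶠ t : ℝ in 𝓝 0, -2 * a + t * b < 0 := by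
    have hc : Continuous fun t : ℝ => -2 * a + t * b := by fun_prop
    exact hc.continuousAt.eventually_lt continuousAt_const (by simp [ha])
  filter_upwards [nhdsWithin_le_nhds h, self_mem_nhdsWithin] with t ht ht0
  have := mul_neg_of_pos_of_neg (Set.mem_Ioi.1 ht0) ht
  nlinarith

lemma closure_genDisk {V : Fin 4 → ℝ} (hV : lorentz V V = 1) :
    closure (genDisk V) = {w | quadForm V w ≤ 0} := by
  apply Set.Subset.antisymm
  · exact closure_minimal (fun w hw => Set.mem_ofPred.2 (le_of_lt hw))
      (isClosed_le (continuous_quadForm V) continuous_const)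
  · intro w hw
    rcases lt_or_eq_of_le (show quadForm V w ≤ 0 from hw) with h | h
    · exact subset_closure h
    · set d : ℂ := ⟨V 1 - V 0 * w.re, V 2 - V 0 * w.im⟩
      have hd : d.re ^ 2 + d.im ^ 2 = 1 := by
        have := normal_sq hV w
        rw [h] at this; simpa [d] using this
      have ht : Tendsto (fun t : ℝ => w + t * d) (𝓝[>] 0) (𝓝 w) := by
        have : Continuous fun t : ℝ => w + t * d := by fun_prop
        have h0 := this.tendsto 0
        simp only [Complex.ofReal_zero, zero_mul, add_zero] at h0
        exact h0.mono_left nhdsWithin_le_nhds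
      refine mem_closure_of_tendsto ht ?_
      filter_upwards [eventually_neg_of_linear_neg one_pos (V 0)] with t ht
      show quadForm V _ < 0
      rw [quadForm_line, h, hd]
      have : (V 1 - V 0 * w.re) * d.re + (V 2 - V 0 * w.im) * d.im = 1 := by
        rw [← hd]; simp only [d]; ring
      rw [this]; linarith

lemma genDisk_eq_ball {V : Fin 4 → ℝ} (hV : lorentz V V = 1) (hk : 0 < V 0) :
    genDisk V = Metric.ball ⟨V 1 / V 0, V 2 / V 0⟩ (V 0)⁻¹ := by
  ext w
  have h1 : w ∈ Metric.ball (⟨V 1 / V 0, V 2 / V 0⟩ : ℂ) (V 0)⁻¹ ↔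
      (w.re - V 1 / V 0) ^ 2 + (w.im - V 2 / V 0) ^ 2 < ((V 0)⁻¹) ^ 2 := by
    rw [Metric.mem_ball, Complex.dist_eq_re_im, Real.sqrt_lt' (by positivity)]
  have h2 : (w.re - V 1 / V 0) ^ 2 + (w.im - V 2 / V 0) ^ 2 - ((V 0)⁻¹) ^ 2
      = quadForm V w / V 0 := by
    have := normal_sq hV w
    field_simp
    linarith
  rw [h1, ← sub_neg, h2, div_neg_iff]
  constructor
  · intro h; exact Or.inr ⟨h, hk⟩
  · rintro (h | h)
    · linarith [h.2]
    · exact h.1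

lemma isOpenDisk_genDisk {V : Fin 4 → ℝ} (hV : lorentz V V = 1) (hk : 0 < V 0) :
    IsOpenDisk (genDisk V) :=
  ⟨_, _, inv_pos.2 hk, genDisk_eq_ball hV hk⟩

lemma isOpenHalfPlane_genDisk {V : Fin 4 → ℝ} (hV : lorentz V V = 1) (hk : V 0 = 0) :
    IsOpenHalfPlane (genDisk V) := by
  refine ⟨⟨-2 * V 1, 2 * V 2⟩, ?_, -V 3, ?_⟩
  · intro h
    have h1 := congrArg Complex.re h
    have h2 := congrArg Complex.im h
    simp at h1 h2
    simp [lorentz, hk, h1, h2] at hV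
  · ext w
    simp only [genDisk, quadForm, hk, Set.mem_ofPred_eq, Complex.mul_re]
    constructor <;> intro h <;> linarith

lemma exists_genDisk_of_isOpenDisk {D : Set ℂ} (hD : IsOpenDisk D) :
    ∃ V : Fin 4 → ℝ, lorentz V V = 1 ∧ 0 < V 0 ∧ D = genDisk V := by
  obtain ⟨z, r, hr, rfl⟩ := hD
  have hV : lorentz ![r⁻¹, z.re / r, z.im / r, (z.re ^ 2 + z.im ^ 2 - r ^ 2) / r]
      ![r⁻¹, z.re / r, z.im / r, (z.re ^ 2 + z.im ^ 2 - r ^ 2) / r] = 1 := by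
    simp [lorentz]; field_simp; ring
  refine ⟨_, hV, by simpa using hr, ?_⟩
  rw [genDisk_eq_ball hV (by simpa using hr)]
  congr 1
  · apply Complex.ext <;> simp <;> field_simp
  · simp

lemma exists_genDisk_of_isOpenHalfPlane {D : Set ℂ} (hD : IsOpenHalfPlane D) :
    ∃ V : Fin 4 → ℝ, lorentz V V = 1 ∧ V 0 = 0 ∧ D = genDisk V := by
  obtain ⟨a, ha, c, rfl⟩ := hD
  have hn : 0 < ‖a‖ := norm_pos_iff.2 ha
  have hs : a.re ^ 2 + a.im ^ 2 = ‖a‖ ^ 2 := by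
    rw [← Complex.normSq_eq_norm_sq, Complex.normSq_apply]; ring
  refine ⟨![0, -a.re / ‖a‖, a.im / ‖a‖, -2 * c / ‖a‖], ?_, rfl, ?_⟩
  · simp [lorentz]; field_simp; linarith
  · ext w
    simp only [genDisk, quadForm, Set.mem_ofPred_eq, Complex.mul_re]
    have : (![0, -a.re / ‖a‖, a.im / ‖a‖, -2 * c / ‖a‖] : Fin 4 → ℝ) 0 * (w.re ^ 2 + w.im ^ 2)
        - 2 * ((![0, -a.re / ‖a‖, a.im / ‖a‖, -2 * c / ‖a‖] : Fin 4 → ℝ) 1 * w.re +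
          (![0, -a.re / ‖a‖, a.im / ‖a‖, -2 * c / ‖a‖] : Fin 4 → ℝ) 2 * w.im)
        + (![0, -a.re / ‖a‖, a.im / ‖a‖, -2 * c / ‖a‖] : Fin 4 → ℝ) 3
        = (2 / ‖a‖) * (a.re * w.re - a.im * w.im - c) := by
      simp; field_simp; ring
    rw [this]
    have h2 : 0 < 2 / ‖a‖ := by positivity
    constructor
    · intro h; exact mul_neg_of_pos_of_neg h2 (by linarith)
    · intro h
      have := neg_of_mul_neg_right h h2.le
      linarith

lemma not_isOpenDisk_genDisk {V : Fin 4 → ℝ} (hV : lorentz V V = 1) (hk : V 0 = 0) :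
    ¬ IsOpenDisk (genDisk V) := by
  rintro ⟨z, r, hr, h⟩
  have h1 : V 1 ^ 2 + V 2 ^ 2 = 1 := by
    simpa [lorentz, hk, pow_two] using hV
  have hz : z ∈ genDisk V := h ▸ Metric.mem_ball_self hr
  have hmem : z + (r : ℝ) * (⟨V 1, V 2⟩ : ℂ) ∈ genDisk V := by
    show quadForm V _ < 0
    rw [quadForm_line]
    have hz' : quadForm V z < 0 := hz
    simp only [hk, zero_mul, sub_zero, mul_zero, add_zero]
    nlinarith
  rw [h, Metric.mem_ball, dist_self_add_left, norm_mul, Complex.norm_real, Complex.norm_def,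
    Complex.normSq_mk, show V 1 * V 1 + V 2 * V 2 = 1 by linarith] at hmem
  simp [abs_of_pos hr] at hmem

lemma diskRadius_ball (z : ℂ) {r : ℝ} (hr : 0 < r) : diskRadius (Metric.ball z r) = r := by
  have h : 0 < diskRadius (Metric.ball z r) ∧
      ∃ z' : ℂ, Metric.ball z r = Metric.ball z' (diskRadius (Metric.ball z r)) :=
    Classical.epsilon_spec (p := fun s : ℝ => 0 < s ∧ ∃ z' : ℂ, Metric.ball z r = Metric.ball z' s)
      ⟨r, hr, z, rfl⟩
  obtain ⟨h0, z', h'⟩ := h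
  have hd := congrArg Metric.diam h'
  rw [Metric.diam_ball_eq z hr.le, Metric.diam_ball_eq z' h0.le] at hd
  linarith

lemma curv_genDisk {V : Fin 4 → ℝ} (hV : lorentz V V = 1) (hk : 0 ≤ V 0) :
    curv (genDisk V) = V 0 := by
  unfold curv
  rcases hk.eq_or_lt with h | h
  · rw [if_neg (not_isOpenDisk_genDisk hV h.symm), h]
  · rw [if_pos (isOpenDisk_genDisk hV h), genDisk_eq_ball hV h,
      diskRadius_ball _ (inv_pos.2 h), inv_inv]

lemma quadForm_add_eq {V W : Fin 4 → ℝ} (hV : lorentz V V = 1) (hW : lorentz W W = 1)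
    (hVW : lorentz V W = -1) (hk : V 0 + W 0 ≠ 0) (w : ℂ) :
    quadForm V w + quadForm W w = (V 0 + W 0) *
      ((w.re - (V 1 + W 1) / (V 0 + W 0)) ^ 2 + (w.im - (V 2 + W 2) / (V 0 + W 0)) ^ 2) := by
  have hn : (V 1 + W 1) ^ 2 + (V 2 + W 2) ^ 2 = (V 0 + W 0) * (V 3 + W 3) := by
    unfold lorentz at *; linarith
  field_simp
  unfold quadForm
  linear_combination (-1 : ℝ) * hn

lemma quadForm_tangency_left {V W : Fin 4 → ℝ} (hV : lorentz V V = 1) (hW : lorentz W W = 1)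
    (hVW : lorentz V W = -1) (hk : V 0 + W 0 ≠ 0) :
    quadForm V ⟨(V 1 + W 1) / (V 0 + W 0), (V 2 + W 2) / (V 0 + W 0)⟩ = 0 := by
  have hn : (V 1 + W 1) ^ 2 + (V 2 + W 2) ^ 2 = (V 0 + W 0) * (V 3 + W 3) := by
    unfold lorentz at *; linarith
  have h1 : quadForm V ⟨(V 1 + W 1) / (V 0 + W 0), (V 2 + W 2) / (V 0 + W 0)⟩ * (V 0 + W 0) ^ 2
     = V 0 * ((V 1 + W 1) ^ 2 + (V 2 + W 2) ^ 2)
       - 2 * (V 1 * (V 1 + W 1) + V 2 * (V 2 + W 2)) * (V 0 + W 0) + V 3 * (V 0 + W 0) ^ 2 := by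
    simp only [quadForm]; field_simp
  have h2 : lorentz V V + lorentz V W = 0 := by rw [hV, hVW]; ring
  have h3 : quadForm V ⟨(V 1 + W 1) / (V 0 + W 0), (V 2 + W 2) / (V 0 + W 0)⟩ * (V 0 + W 0) ^ 2
      = 0 := by
    rw [h1, hn]
    unfold lorentz at h2
    linear_combination (-2 * (V 0 + W 0)) * h2
  rcases mul_eq_zero.1 h3 with h | h
  · exact h
  · exact absurd (pow_eq_zero_iff (two_ne_zero)|>.1 h) hk

lemma closure_inter_closure_genDisk {V W : Fin 4 → ℝ} (hV : lorentz V V = 1)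
    (hW : lorentz W W = 1) (hVW : lorentz V W = -1) (hk : 0 < V 0 + W 0) :
    closure (genDisk V) ∩ closure (genDisk W) =
      {⟨(V 1 + W 1) / (V 0 + W 0), (V 2 + W 2) / (V 0 + W 0)⟩} := by
  rw [closure_genDisk hV, closure_genDisk hW]
  ext w
  simp only [Set.mem_inter_iff, Set.mem_ofPred_eq, Set.mem_singleton_iff]
  constructor
  · rintro ⟨h1, h2⟩
    have h := quadForm_add_eq hV hW hVW hk.ne' w
    have h3 : (w.re - (V 1 + W 1) / (V 0 + W 0)) ^ 2 + (w.im - (V 2 + W 2) / (V 0 + W 0)) ^ 2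
        ≤ 0 := by
      by_contra hc
      push Not at hc
      have := mul_pos hk hc
      linarith
    apply Complex.ext
    · show w.re = _
      nlinarith [sq_nonneg (w.re - (V 1 + W 1) / (V 0 + W 0)),
        sq_nonneg (w.im - (V 2 + W 2) / (V 0 + W 0))]
    · show w.im = _
      nlinarith [sq_nonneg (w.re - (V 1 + W 1) / (V 0 + W 0)),
        sq_nonneg (w.im - (V 2 + W 2) / (V 0 + W 0))]
  · rintro rfl
    refine ⟨(quadForm_tangency_left hV hW hVW hk.ne').le, ?_⟩
    have := quadForm_tangency_left hW hV (lorentz_comm V W ▸ hVW) (by rw [add_comm]; exact hk.ne')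
    rw [add_comm (V 0), add_comm (V 1), add_comm (V 2), this]

/-- Generalized disks whose closures meet in a single point are externally tangent. -/
lemma lorentz_eq_neg_one_of_tangent {V W : Fin 4 → ℝ} (hV : lorentz V V = 1)
    (hW : lorentz W W = 1) {p : ℂ} (hp : closure (genDisk V) ∩ closure (genDisk W) = {p}) :
    lorentz V W = -1 := by
  have hdisj : genDisk V ∩ genDisk W = ∅ := by
    by_contra hne
    have hsub : genDisk V ∩ genDisk W ⊆ {p} := hp ▸
      Set.inter_subset_inter subset_closure subset_closure
    have heq := (Set.subset_singleton_iff_eq.1 hsub).resolve_left hne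
    exact not_isOpen_singleton p (heq ▸ (isOpen_genDisk V).inter (isOpen_genDisk W))
  have hmem : p ∈ closure (genDisk V) ∩ closure (genDisk W) := hp ▸ rfl
  have hVp : quadForm V p = 0 := by
    refine le_antisymm (by have := hmem.1; rwa [closure_genDisk hV] at this) ?_
    by_contra hc
    push Not at hc
    obtain ⟨x, hx⟩ := mem_closure_iff.1 hmem.2 _ (isOpen_genDisk V) hc
    rw [hdisj] at hx; exact hx
  have hWp : quadForm W p = 0 := by
    refine le_antisymm (by have := hmem.2; rwa [closure_genDisk hW] at this) ?_
    by_contra hc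
    push Not at hc
    obtain ⟨x, hx⟩ := mem_closure_iff.1 hmem.1 _ (isOpen_genDisk W) hc
    rw [Set.inter_comm, hdisj] at hx; exact hx
  have nV := normal_sq hV p
  have nW := normal_sq hW p
  have hdot : (V 1 - V 0 * p.re) * (W 1 - W 0 * p.re) + (V 2 - V 0 * p.im) * (W 2 - W 0 * p.im)
      = lorentz V W := by
    unfold lorentz
    unfold quadForm at hVp hWp
    linear_combination (W 0 / 2) * hVp + (V 0 / 2) * hWp
  rw [hVp] at nV
  rw [hWp] at nW
  set d : ℂ := ⟨(V 1 - V 0 * p.re) + (W 1 - W 0 * p.re), (V 2 - V 0 * p.im) + (W 2 - W 0 * p.im)⟩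
  have hge : -1 ≤ lorentz V W := by
    rw [← hdot]
    nlinarith [sq_nonneg d.re, sq_nonneg d.im]
  by_contra hne
  have hpos : 0 < 1 + lorentz V W := by
    have := lt_of_le_of_ne hge (Ne.symm hne)
    linarith
  obtain ⟨t, ht1, ht2⟩ := ((eventually_neg_of_linear_neg hpos (V 0 * (d.re ^ 2 + d.im ^ 2))).and
    (eventually_neg_of_linear_neg hpos (W 0 * (d.re ^ 2 + d.im ^ 2)))).exists
  have : p + t * d ∈ genDisk V ∩ genDisk W := by
    constructor
    · show quadForm V _ < 0
      rw [quadForm_line, hVp]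
      have : (V 1 - V 0 * p.re) * d.re + (V 2 - V 0 * p.im) * d.im = 1 + lorentz V W := by
        rw [← hdot]; simp only [d]; linear_combination nV
      rw [this]; linarith
    · show quadForm W _ < 0
      rw [quadForm_line, hWp]
      have : (W 1 - W 0 * p.re) * d.re + (W 2 - W 0 * p.im) * d.im = 1 + lorentz V W := by
        rw [← hdot]; simp only [d]; linear_combination nW
      rw [this]; linarith
  rw [hdisj] at this
  exact this

/-- The Gram matrix of three mutually tangent generalized disks and their dual disk. -/
noncomputable def gramMat : Matrix (Fin 4) (Fin 4) ℝ :=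
  !![1, -1, -1, 0; -1, 1, -1, 0; -1, -1, 1, 0; 0, 0, 0, 1]

/-- The inverse of `gramMat`. -/
noncomputable def gramInv : Matrix (Fin 4) (Fin 4) ℝ :=
  !![0, -1/2, -1/2, 0; -1/2, 0, -1/2, 0; -1/2, -1/2, 0, 0; 0, 0, 0, 1]

/-- The matrix of the Lorentz form. -/
noncomputable def lorentzMat : Matrix (Fin 4) (Fin 4) ℝ :=
  !![0, 0, 0, -1/2; 0, 1, 0, 0; 0, 0, 1, 0; -1/2, 0, 0, 0]

/-- The inverse of `lorentzMat`. -/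
noncomputable def lorentzInv : Matrix (Fin 4) (Fin 4) ℝ :=
  !![0, 0, 0, -2; 0, 1, 0, 0; 0, 0, 1, 0; -2, 0, 0, 0]

/-- The columns of `F` represent three mutually tangent generalized disks of nonnegative
curvature, followed by the disk bounded by the circle through the tangency points. -/
structure IsFrame (F : Matrix (Fin 4) (Fin 4) ℝ) : Prop where
  gram_eq : Fᵀ * lorentzMat * F = gramMat
  nonneg : ∀ j : Fin 3, 0 ≤ F 0 j.castSucc
  pos : 0 < F 0 3

/-- The values at `w` of the quadratic polynomials attached to the columns of `F`. -/
noncomputable def coords (F : Matrix (Fin 4) (Fin 4) ℝ) (w : ℂ) : Fin 4 → ℝ :=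
  fun j => quadForm (Fᵀ j) w

/-- The dual coordinates of `x` with respect to the Gram matrix. -/
noncomputable def weight (x : Fin 4 → ℝ) : Fin 4 → ℝ :=
  ![(x 1 + x 2) / 4, (x 2 + x 0) / 4, (x 0 + x 1) / 4, -x 3 / 2]

/-- The bilinear form dual to the Gram matrix. -/
noncomputable def polar (x y : Fin 4 → ℝ) : ℝ :=
  -(x 0 * y 1 + x 1 * y 0 + x 1 * y 2 + x 2 * y 1 + x 2 * y 0 + x 0 * y 2) / 2 + x 3 * y 3

/-- The point of `ℂ` whose coordinates with respect to `F` are proportional to `x`. -/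
noncomputable def point (F : Matrix (Fin 4) (Fin 4) ℝ) (x : Fin 4 → ℝ) : ℂ :=
  ⟨(F 1 ⬝ᵥ weight x) / (F 0 ⬝ᵥ weight x), (F 2 ⬝ᵥ weight x) / (F 0 ⬝ᵥ weight x)⟩

/-- The inhomogeneous light-cone vector of `w`. -/
noncomputable def lightVec (w : ℂ) : Fin 4 → ℝ := ![w.re ^ 2 + w.im ^ 2, -2 * w.re, -2 * w.im, 1]

lemma coords_eq_vecMul (F : Matrix (Fin 4) (Fin 4) ℝ) (w : ℂ) :
    coords F w = lightVec w ᵥ* F := by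
  ext j
  simp [coords, lightVec, quadForm, vecMul, dotProduct, Fin.sum_univ_four]
  ring

lemma coords_mul (F M : Matrix (Fin 4) (Fin 4) ℝ) (w : ℂ) :
    coords (F * M) w = coords F w ᵥ* M := by
  rw [coords_eq_vecMul, coords_eq_vecMul, vecMul_vecMul]

lemma continuous_coords (F : Matrix (Fin 4) (Fin 4) ℝ) : Continuous (coords F) :=
  continuous_pi fun _ => continuous_quadForm _

lemma weight_eq (x : Fin 4 → ℝ) : weight x = (-1 / 2 : ℝ) • (gramInv *ᵥ x) := by
  ext j
  fin_cases j <;> simp [weight, gramInv, dotProduct, Fin.sum_univ_four] <;> ring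

lemma polar_eq (x y : Fin 4 → ℝ) : polar x y = x ⬝ᵥ (gramInv *ᵥ y) := by
  simp [polar, gramInv, mulVec, dotProduct, Fin.sum_univ_four]; ring

lemma polar_smul (a b : ℝ) (x y : Fin 4 → ℝ) : polar (a • x) (b • y) = a * b * polar x y := by
  simp [polar]; ring

lemma lorentz_eq (V W : Fin 4 → ℝ) : lorentz V W = V ⬝ᵥ (lorentzMat *ᵥ W) := by
  simp [lorentz, lorentzMat, mulVec, dotProduct, Fin.sum_univ_four]; ring

lemma gramMat_mul_gramInv : gramMat * gramInv = 1 := by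
  ext i j
  fin_cases i <;> fin_cases j <;>
    simp [gramMat, gramInv, Matrix.mul_apply, Fin.sum_univ_four] <;> norm_num

lemma lorentzMat_mul_lorentzInv : lorentzMat * lorentzInv = 1 := by
  ext i j
  fin_cases i <;> fin_cases j <;>
    simp [lorentzMat, lorentzInv, Matrix.mul_apply, Fin.sum_univ_four]

lemma lorentz_col (F : Matrix (Fin 4) (Fin 4) ℝ) (i j : Fin 4) :
    lorentz (Fᵀ i) (Fᵀ j) = (Fᵀ * lorentzMat * F) i j := by
  rw [lorentz_eq, Matrix.mul_assoc]
  rfl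

namespace IsFrame

variable {F F' : Matrix (Fin 4) (Fin 4) ℝ}

lemma lorentz_eq_gramMat (hF : IsFrame F) (i j : Fin 4) : lorentz (Fᵀ i) (Fᵀ j) = gramMat i j := by
  rw [lorentz_col, hF.gram_eq]

lemma nonneg0 (hF : IsFrame F) : 0 ≤ F 0 0 := hF.nonneg 0
lemma nonneg1 (hF : IsFrame F) : 0 ≤ F 0 1 := hF.nonneg 1
lemma nonneg2 (hF : IsFrame F) : 0 ≤ F 0 2 := hF.nonneg 2

lemma dual (hF : IsFrame F) : F * gramInv * Fᵀ = lorentzInv := by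
  have h1 : (gramInv * Fᵀ * lorentzMat) * F = 1 := by
    rw [Matrix.mul_assoc, Matrix.mul_assoc, ← Matrix.mul_assoc Fᵀ, hF.gram_eq,
      mul_eq_one_comm.1 gramMat_mul_gramInv]
  have h2 := mul_eq_one_comm.1 h1
  calc F * gramInv * Fᵀ = F * gramInv * Fᵀ * (lorentzMat * lorentzInv) := by
        rw [lorentzMat_mul_lorentzInv, Matrix.mul_one]
    _ = F * (gramInv * Fᵀ * lorentzMat) * lorentzInv := by simp only [Matrix.mul_assoc]
    _ = lorentzInv := by rw [h2, Matrix.one_mul]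

lemma polar_coords (hF : IsFrame F) (w w' : ℂ) :
    polar (coords F w) (coords F w') = -2 * dist w w' ^ 2 := by
  have h : polar (coords F w) (coords F w') = lightVec w ⬝ᵥ (lorentzInv *ᵥ lightVec w') := by
    rw [polar_eq, coords_eq_vecMul, coords_eq_vecMul, ← hF.dual, ← mulVec_transpose F (lightVec w'),
      ← dotProduct_mulVec, mulVec_mulVec, mulVec_mulVec, Matrix.mul_assoc]
  rw [h, Complex.dist_eq_re_im, Real.sq_sqrt (by positivity)]
  simp [lorentzInv, lightVec, mulVec, dotProduct, Fin.sum_univ_four]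
  ring

lemma polar_self (hF : IsFrame F) (w : ℂ) : polar (coords F w) (coords F w) = 0 := by
  rw [hF.polar_coords]; simp

lemma mulVec_weight_coords (hF : IsFrame F) (w : ℂ) :
    F *ᵥ weight (coords F w) = ![1, w.re, w.im, w.re ^ 2 + w.im ^ 2] := by
  have h : F *ᵥ weight (coords F w) = (-1 / 2 : ℝ) • (lorentzInv *ᵥ lightVec w) := by
    rw [weight_eq, mulVec_smul, ← hF.dual, coords_eq_vecMul, ← mulVec_transpose, mulVec_mulVec,
      mulVec_mulVec, Matrix.mul_assoc]
  rw [h]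
  ext j
  fin_cases j <;> simp [lorentzInv, lightVec] <;> ring

lemma dotProduct_weight_coords (hF : IsFrame F) (w : ℂ) : F 0 ⬝ᵥ weight (coords F w) = 1 :=
  congrFun (hF.mulVec_weight_coords w) 0

lemma point_coords (hF : IsFrame F) (w : ℂ) : point F (coords F w) = w := by
  have h := hF.mulVec_weight_coords w
  have h0 : F 0 ⬝ᵥ weight (coords F w) = 1 := congrFun h 0
  have h1 : F 1 ⬝ᵥ weight (coords F w) = w.re := congrFun h 1
  have h2 : F 2 ⬝ᵥ weight (coords F w) = w.im := congrFun h 2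
  simp [point, h0, h1, h2]

lemma coords_point (hF : IsFrame F) {x : Fin 4 → ℝ} (hx : polar x x = 0)
    (h0 : F 0 ⬝ᵥ weight x ≠ 0) : coords F (point F x) = (F 0 ⬝ᵥ weight x)⁻¹ • x := by
  set n := F *ᵥ weight x with hn
  have hn0 : F 0 ⬝ᵥ weight x = n 0 := rfl
  have hnull : lorentz n n = 0 := by
    have : n ⬝ᵥ (lorentzMat *ᵥ n) = weight x ⬝ᵥ (gramMat *ᵥ weight x) := by
      rw [← hF.gram_eq, hn, ← mulVec_mulVec, ← mulVec_mulVec, dotProduct_mulVec _ Fᵀ,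
        vecMul_transpose]
    rw [lorentz_eq, this, weight_eq, mulVec_smul, mulVec_mulVec, gramMat_mul_gramInv, one_mulVec,
      dotProduct_smul, smul_dotProduct, dotProduct_comm, ← polar_eq, hx]
    simp
  have hx' : x = (-2 : ℝ) • (Fᵀ *ᵥ (lorentzMat *ᵥ n)) := by
    rw [hn, mulVec_mulVec, mulVec_mulVec, hF.gram_eq, weight_eq, mulVec_smul, mulVec_mulVec,
      gramMat_mul_gramInv, one_mulVec, smul_smul]
    norm_num
  have hpt : lightVec (point F x) = (-2 / n 0) • (lorentzMat *ᵥ n) := by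
    have hp : point F x = ⟨n 1 / n 0, n 2 / n 0⟩ := rfl
    rw [hn0] at h0
    rw [hp]
    clear_value n
    have h12 : n 1 ^ 2 + n 2 ^ 2 = n 0 * n 3 := by
      unfold lorentz at hnull; linarith
    have h3 : (n 1 / n 0) ^ 2 + (n 2 / n 0) ^ 2 = n 3 / n 0 := by
      field_simp; linarith
    ext j
    fin_cases j <;>
      simp [lightVec, lorentzMat, dotProduct, Fin.sum_univ_four, h3]
      <;> field_simp
  rw [coords_eq_vecMul, hpt, ← mulVec_transpose, mulVec_smul, hn0]
  conv_rhs => rw [hx']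
  rw [smul_smul]
  congr 1
  ring

lemma curv_sq (hF : IsFrame F) :
    F 0 3 ^ 2 = F 0 0 * F 0 1 + F 0 1 * F 0 2 + F 0 2 * F 0 0 := by
  have h := congrFun (congrFun hF.dual 0) 0
  simp [lorentzInv, gramInv, Matrix.mul_apply, Fin.sum_univ_four] at h
  linarith

end IsFrame

/-- The closed cone of coordinate vectors of points of a closed ideal triangle. -/
def triCone : Set (Fin 4 → ℝ) :=
  {x | 0 ≤ x 0 ∧ 0 ≤ x 1 ∧ 0 ≤ x 2 ∧ x 3 ≤ 0 ∧ polar x x = 0 ∧ 0 < x 0 + x 1 + x 2}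

/-- The coordinate vectors of points of an open ideal triangle. -/
def openTriCone : Set (Fin 4 → ℝ) :=
  {x | 0 < x 0 ∧ 0 < x 1 ∧ 0 < x 2 ∧ x 3 < 0 ∧ polar x x = 0}

lemma openTriCone_subset : openTriCone ⊆ triCone := fun _ h =>
  ⟨h.1.le, h.2.1.le, h.2.2.1.le, h.2.2.2.1.le, h.2.2.2.2, by linarith [h.1, h.2.1, h.2.2.1]⟩

lemma smul_mem_openTriCone {x : Fin 4 → ℝ} (hx : x ∈ openTriCone) {a : ℝ} (ha : 0 < a) :
    a • x ∈ openTriCone := by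
  obtain ⟨h0, h1, h2, h3, h4⟩ := hx
  exact ⟨mul_pos ha h0, mul_pos ha h1, mul_pos ha h2,
    mul_neg_of_pos_of_neg ha h3, by rw [polar_smul, h4, mul_zero]⟩

/-- The open ideal triangle of a frame. -/
def openTri (F : Matrix (Fin 4) (Fin 4) ℝ) : Set ℂ := {w | coords F w ∈ openTriCone}

/-- The closed ideal triangle of a frame. -/
def closedTri (F : Matrix (Fin 4) (Fin 4) ℝ) : Set ℂ := {w | coords F w ∈ triCone}

namespace IsFrame

variable {F F' : Matrix (Fin 4) (Fin 4) ℝ}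

lemma dotProduct_weight_pos (hF : IsFrame F) {x : Fin 4 → ℝ} (hx : x ∈ triCone) :
    0 < F 0 ⬝ᵥ weight x := by
  obtain ⟨h0, h1, h2, h3, h4, h5⟩ := hx
  have e : F 0 ⬝ᵥ weight x = (F 0 0 * (x 1 + x 2) + F 0 1 * (x 2 + x 0) + F 0 2 * (x 0 + x 1)) / 4
      + F 0 3 * (-x 3) / 2 := by
    simp [weight, dotProduct, Fin.sum_univ_four]; ring
  have g0 := hF.nonneg0
  have g1 := hF.nonneg1
  have g2 := hF.nonneg2
  have g3 := hF.pos
  have t0 := mul_nonneg g0 (add_nonneg h1 h2)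
  have t1 := mul_nonneg g1 (add_nonneg h2 h0)
  have t2 := mul_nonneg g2 (add_nonneg h0 h1)
  rw [e]
  rcases h3.lt_or_eq with h | h
  · have := mul_pos g3 (neg_pos.2 h)
    linarith
  · have t3 : 0 < F 0 0 * F 0 1 + F 0 1 * F 0 2 + F 0 2 * F 0 0 := by
      rw [← hF.curv_sq]; positivity
    rw [h]
    by_contra hc
    have z0 : F 0 0 * (x 1 + x 2) = 0 := by linarith
    have z1 : F 0 1 * (x 2 + x 0) = 0 := by linarith
    have z2 : F 0 2 * (x 0 + x 1) = 0 := by linarith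
    rcases h0.eq_or_lt with a | a
    · rcases h1.eq_or_lt with b | b
      · have c : 0 < x 2 := by linarith
        have y0 : F 0 0 = 0 := (mul_eq_zero.1 z0).resolve_right (by linarith)
        have y1 : F 0 1 = 0 := (mul_eq_zero.1 z1).resolve_right (by linarith)
        simp [y0, y1] at t3
      · have y0 : F 0 0 = 0 := (mul_eq_zero.1 z0).resolve_right (by linarith)
        have y1 : F 0 2 = 0 := (mul_eq_zero.1 z2).resolve_right (by linarith)
        simp [y0, y1] at t3
    · have y0 : F 0 1 = 0 := (mul_eq_zero.1 z1).resolve_right (by linarith)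
      have y1 : F 0 2 = 0 := (mul_eq_zero.1 z2).resolve_right (by linarith)
      simp [y0, y1] at t3

lemma coords_mem_triCone_iff (hF : IsFrame F) (w : ℂ) : w ∈ closedTri F ↔
    0 ≤ coords F w 0 ∧ 0 ≤ coords F w 1 ∧ 0 ≤ coords F w 2 ∧ coords F w 3 ≤ 0 := by
  constructor
  · rintro ⟨h0, h1, h2, h3, -⟩
    exact ⟨h0, h1, h2, h3⟩
  · rintro ⟨h0, h1, h2, h3⟩
    refine ⟨h0, h1, h2, h3, hF.polar_self w, ?_⟩
    by_contra hc
    have z0 : coords F w 0 = 0 := by linarith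
    have z1 : coords F w 1 = 0 := by linarith
    have z2 : coords F w 2 = 0 := by linarith
    have hp := hF.polar_self w
    have hd := hF.dotProduct_weight_coords w
    simp only [polar, z0, z1, z2] at hp
    have z3 : coords F w 3 = 0 := by nlinarith
    simp [weight, z0, z1, z2, z3, dotProduct, Fin.sum_univ_four] at hd

lemma isClosed_closedTri (hF : IsFrame F) : IsClosed (closedTri F) := by
  have : closedTri F = {w | 0 ≤ coords F w 0} ∩ {w | 0 ≤ coords F w 1} ∩ {w | 0 ≤ coords F w 2}
      ∩ {w | coords F w 3 ≤ 0} := by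
    ext w
    rw [hF.coords_mem_triCone_iff]
    simp only [Set.mem_inter_iff, Set.mem_ofPred_eq]
    tauto
  rw [this]
  have hc : ∀ j, Continuous fun w => coords F w j := fun j => continuous_quadForm _
  exact (((isClosed_le continuous_const (hc 0)).inter (isClosed_le continuous_const (hc 1))).inter
    (isClosed_le continuous_const (hc 2))).inter (isClosed_le (hc 3) continuous_const)

lemma closure_openTri_subset (hF : IsFrame F) : closure (openTri F) ⊆ closedTri F :=
  closure_minimal (fun _ hw => openTriCone_subset hw) hF.isClosed_closedTri

lemma coords_transition (hF : IsFrame F) (hF' : IsFrame F') {w : ℂ} (hw : w ∈ closedTri F) :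
    coords F' (point F' (coords F w)) = (F' 0 ⬝ᵥ weight (coords F w))⁻¹ • coords F w :=
  hF'.coords_point (hF.polar_self w) (hF'.dotProduct_weight_pos hw).ne'

lemma weight_smul (a : ℝ) (x : Fin 4 → ℝ) : weight (a • x) = a • weight x := by
  ext j
  fin_cases j <;> simp [weight] <;> ring

lemma transition_transition (hF : IsFrame F) (hF' : IsFrame F') {w : ℂ} (hw : w ∈ closedTri F) :
    point F (coords F' (point F' (coords F w))) = w := by
  rw [hF.coords_transition hF' hw]
  have ha := (inv_pos.2 (hF'.dotProduct_weight_pos hw)).ne'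
  set a := (F' 0 ⬝ᵥ weight (coords F w))⁻¹
  conv_rhs => rw [← hF.point_coords w]
  simp only [point, weight_smul, dotProduct_smul, smul_eq_mul]
  rw [mul_div_mul_left _ _ ha, mul_div_mul_left _ _ ha]

lemma transition_mem_openTri (hF : IsFrame F) (hF' : IsFrame F') {w : ℂ} (hw : w ∈ openTri F) :
    point F' (coords F w) ∈ openTri F' := by
  have hw' : w ∈ closedTri F := openTriCone_subset hw
  show coords F' _ ∈ openTriCone
  rw [hF.coords_transition hF' hw']
  exact smul_mem_openTriCone hw (inv_pos.2 (hF'.dotProduct_weight_pos hw'))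

lemma continuous_weight : Continuous weight := by
  refine continuous_pi fun j => ?_
  fin_cases j <;> simp [weight] <;> fun_prop

lemma continuousOn_point (hF : IsFrame F) : ContinuousOn (point F) triCone := by
  have hc : ∀ i, Continuous fun x => F i ⬝ᵥ weight x := fun i =>
    Continuous.dotProduct continuous_const continuous_weight
  have h1 : ContinuousOn (fun x => (F 1 ⬝ᵥ weight x) / (F 0 ⬝ᵥ weight x)) triCone :=
    (hc 1).continuousOn.div (hc 0).continuousOn fun x hx => (hF.dotProduct_weight_pos hx).ne'
  have h2 : ContinuousOn (fun x => (F 2 ⬝ᵥ weight x) / (F 0 ⬝ᵥ weight x)) triCone :=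
    (hc 2).continuousOn.div (hc 0).continuousOn fun x hx => (hF.dotProduct_weight_pos hx).ne'
  exact Complex.equivRealProdCLM.symm.continuous.comp_continuousOn (h1.prodMk h2)

lemma transition_mem_closure (hF : IsFrame F) (hF' : IsFrame F') {w : ℂ}
    (hw : w ∈ closure (openTri F)) : point F' (coords F w) ∈ closure (openTri F') := by
  have hc : ContinuousOn (fun w => point F' (coords F w)) (closure (openTri F)) :=
    hF'.continuousOn_point.comp (continuous_coords F).continuousOn hF.closure_openTri_subset
  exact closure_mono
    (Set.image_subset_iff.2 (fun w hw => hF.transition_mem_openTri hF' hw) :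
      (fun w => point F' (coords F w)) '' openTri F ⊆ openTri F')
    (hc.image_closure (Set.mem_image_of_mem _ hw))

lemma dist_transition (hF : IsFrame F) (hF' : IsFrame F') {w w' : ℂ}
    (hw : w ∈ closedTri F) (hw' : w' ∈ closedTri F) :
    dist (point F' (coords F w)) (point F' (coords F w')) ^ 2 =
      (F' 0 ⬝ᵥ weight (coords F w))⁻¹ * (F' 0 ⬝ᵥ weight (coords F w'))⁻¹ * dist w w' ^ 2 := by
  have h := hF'.polar_coords (point F' (coords F w)) (point F' (coords F w'))
  rw [hF.coords_transition hF' hw, hF.coords_transition hF' hw', polar_smul,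
    hF.polar_coords] at h
  linarith

/-- The transition map between closed ideal triangles is Lipschitz. -/
lemma dist_transition_le (hF : IsFrame F) (hF' : IsFrame F') {c : ℝ} (hc : 0 < c)
    (h : ∀ x ∈ triCone, F 0 ⬝ᵥ weight x ≤ c * (F' 0 ⬝ᵥ weight x)) {w w' : ℂ}
    (hw : w ∈ closedTri F) (hw' : w' ∈ closedTri F) :
    dist (point F' (coords F w)) (point F' (coords F w')) ≤ c * dist w w' := by
  have key : ∀ w ∈ closedTri F, (F' 0 ⬝ᵥ weight (coords F w))⁻¹ ≤ c := by
    intro w hw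
    have h1 := h _ hw
    rw [hF.dotProduct_weight_coords] at h1
    have h2 := hF'.dotProduct_weight_pos hw
    rw [inv_eq_one_div, div_le_iff₀ h2]
    exact h1
  have hp := inv_pos.2 (hF'.dotProduct_weight_pos hw')
  refine (pow_le_pow_iff_left₀ dist_nonneg (by positivity) two_ne_zero).1 ?_
  rw [hF.dist_transition hF' hw hw', mul_pow, pow_two c]
  gcongr
  · exact key w hw
  · exact key w' hw'

end IsFrame

/-- The three generalized disks of a frame. -/
def tripleOfFrame (F : Matrix (Fin 4) (Fin 4) ℝ) : Fin 3 → Set ℂ :=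
  fun j => genDisk (Fᵀ j.castSucc)

lemma mem_openTriCone_of_pos {x : Fin 3 → ℝ}
    (hx : x ∈ Set.univ.pi fun _ : Fin 3 => Set.Ioi (0 : ℝ)) :
    ![x 0, x 1, x 2, -√(x 0 * x 1 + x 1 * x 2 + x 2 * x 0)] ∈ openTriCone := by
  have h0 : 0 < x 0 := hx 0 trivial
  have h1 : 0 < x 1 := hx 1 trivial
  have h2 : 0 < x 2 := hx 2 trivial
  have hp : 0 < x 0 * x 1 + x 1 * x 2 + x 2 * x 0 := by positivity
  refine ⟨h0, h1, h2, by simpa using Real.sqrt_pos.2 hp, ?_⟩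
  have := Real.mul_self_sqrt hp.le
  simp [polar, this]; ring

namespace IsFrame

variable {F : Matrix (Fin 4) (Fin 4) ℝ}

lemma lorentz_self (hF : IsFrame F) (j : Fin 4) : lorentz (Fᵀ j) (Fᵀ j) = 1 := by
  rw [hF.lorentz_eq_gramMat]
  fin_cases j <;> rfl

lemma closure_tripleOfFrame (hF : IsFrame F) (j : Fin 3) :
    closure (tripleOfFrame F j) = {w | coords F w j.castSucc ≤ 0} :=
  closure_genDisk (hF.lorentz_self _)

lemma compl_iUnion_closure (hF : IsFrame F) : (⋃ j, closure (tripleOfFrame F j))ᶜ =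
    {w | 0 < coords F w 0 ∧ 0 < coords F w 1 ∧ 0 < coords F w 2} := by
  ext w
  simp [hF.closure_tripleOfFrame, Fin.forall_fin_succ]

lemma sq_coords_three (hF : IsFrame F) (w : ℂ) : coords F w 3 ^ 2 =
    coords F w 0 * coords F w 1 + coords F w 1 * coords F w 2 + coords F w 2 * coords F w 0 := by
  have := hF.polar_self w
  unfold polar at this
  linarith

lemma mem_openTri_iff (hF : IsFrame F) (w : ℂ) : w ∈ openTri F ↔
    0 < coords F w 0 ∧ 0 < coords F w 1 ∧ 0 < coords F w 2 ∧ coords F w 3 < 0 :=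
  ⟨fun ⟨h0, h1, h2, h3, _⟩ => ⟨h0, h1, h2, h3⟩, fun ⟨h0, h1, h2, h3⟩ =>
    ⟨h0, h1, h2, h3, hF.polar_self w⟩⟩

lemma openTri_eq_image (hF : IsFrame F) : openTri F =
    (fun x : Fin 3 → ℝ => point F ![x 0, x 1, x 2, -√(x 0 * x 1 + x 1 * x 2 + x 2 * x 0)]) ''
      Set.univ.pi fun _ => Set.Ioi 0 := by
  ext w
  constructor
  · intro hw
    obtain ⟨h0, h1, h2, h3, -⟩ := hw
    refine ⟨![coords F w 0, coords F w 1, coords F w 2], ?_, ?_⟩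
    · intro j _
      fin_cases j <;> simpa
    · have hB : -√(coords F w 0 * coords F w 1 + coords F w 1 * coords F w 2
          + coords F w 2 * coords F w 0) = coords F w 3 := by
        rw [← hF.sq_coords_three, Real.sqrt_sq_eq_abs, abs_of_neg h3, neg_neg]
      have hx : ![coords F w 0, coords F w 1, coords F w 2, coords F w 3] = coords F w := by
        ext j; fin_cases j <;> rfl
      simp only [Matrix.cons_val_zero, Matrix.cons_val_one, Matrix.cons_val, hB]
      rw [hx, hF.point_coords]
  · rintro ⟨x, hx, rfl⟩
    have hm := mem_openTriCone_of_pos hx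
    have hw := hF.dotProduct_weight_pos (openTriCone_subset hm)
    change coords F (point F _) ∈ openTriCone
    rw [hF.coords_point hm.2.2.2.2 hw.ne']
    exact smul_mem_openTriCone hm (inv_pos.2 hw)

lemma isPreconnected_openTri (hF : IsFrame F) : IsPreconnected (openTri F) := by
  rw [hF.openTri_eq_image]
  refine ((convex_pi fun _ _ => convex_Ioi 0).isPreconnected).image _ ?_
  refine hF.continuousOn_point.comp (Continuous.continuousOn ?_)
    fun x hx => openTriCone_subset (mem_openTriCone_of_pos hx)
  refine continuous_pi fun j => ?_
  fin_cases j <;> simp <;> fun_prop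

lemma openTri_nonempty (hF : IsFrame F) : (openTri F).Nonempty := by
  rw [hF.openTri_eq_image]
  exact ⟨_, fun _ => 1, by simp, rfl⟩

lemma isBounded_openTri (hF : IsFrame F) : Bornology.IsBounded (openTri F) := by
  have h : openTri F ⊆ genDisk (Fᵀ 3) := fun w hw => hw.2.2.2.1
  rw [genDisk_eq_ball (hF.lorentz_self 3) hF.pos] at h
  exact Metric.isBounded_ball.subset h

lemma openTri_subset_compl (hF : IsFrame F) :
    openTri F ⊆ (⋃ j, closure (tripleOfFrame F j))ᶜ := by
  rw [hF.compl_iUnion_closure]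
  exact fun w hw => ⟨hw.1, hw.2.1, hw.2.2.1⟩

lemma coords_three_ne_zero (hF : IsFrame F) {w : ℂ}
    (hw : w ∈ (⋃ j, closure (tripleOfFrame F j))ᶜ) : coords F w 3 ≠ 0 := by
  rw [hF.compl_iUnion_closure] at hw
  obtain ⟨h0, h1, h2⟩ := hw
  have h := hF.sq_coords_three w
  have : 0 < coords F w 3 ^ 2 := by rw [h]; positivity
  exact fun h => by simp [h] at this

lemma connectedComponentIn_eq_openTri (hF : IsFrame F) {z : ℂ} (hz : z ∈ openTri F) :
    connectedComponentIn (⋃ j, closure (tripleOfFrame F j))ᶜ z = openTri F := by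
  apply Set.Subset.antisymm
  · have hsub := connectedComponentIn_subset (⋃ j, closure (tripleOfFrame F j))ᶜ z
    have hc : Continuous fun w => coords F w 3 := continuous_quadForm _
    have hneg : connectedComponentIn (⋃ j, closure (tripleOfFrame F j))ᶜ z ⊆
        {w | coords F w 3 < 0} := by
      refine isPreconnected_connectedComponentIn.subset_left_of_subset_union
        (v := {w | 0 < coords F w 3}) (isOpen_lt hc continuous_const)
        (isOpen_lt continuous_const hc) ?_ ?_
        ⟨z, mem_connectedComponentIn (hF.openTri_subset_compl hz), hz.2.2.2.1⟩
      · exact Set.disjoint_left.2 fun w hw hw' => lt_asymm (Set.mem_ofPred.1 hw) hw'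
      · exact fun w hw => lt_or_gt_of_ne (hF.coords_three_ne_zero (hsub hw))
    intro w hw
    have hU := hsub hw
    rw [hF.compl_iUnion_closure] at hU
    exact ⟨hU.1, hU.2.1, hU.2.2, hneg hw, hF.polar_self w⟩
  · exact hF.isPreconnected_openTri.subset_connectedComponentIn hz hF.openTri_subset_compl

/-- The values of a quadratic polynomial orthogonal to `B` along a ray from the center of `B`. -/
lemma quadForm_ray {V B : Fin 4 → ℝ} (hB : lorentz B B = 1) (hVB : lorentz V B = 0)
    (hk : B 0 ≠ 0) (w : ℂ) (t : ℝ) :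
    quadForm V (⟨B 1 / B 0, B 2 / B 0⟩ + t * (w - ⟨B 1 / B 0, B 2 / B 0⟩)) =
      t * quadForm V w + (t - 1) * V 0 * (t * (quadForm B w / B 0) + (t - 1) / B 0 ^ 2) := by
  have hB1 : B 3 = (B 1 ^ 2 + B 2 ^ 2 - 1) / B 0 := by
    field_simp; unfold lorentz at hB; linarith
  have hV3 : V 3 = (2 * (V 1 * B 1 + V 2 * B 2) - V 0 * B 3) / B 0 := by
    field_simp; unfold lorentz at hVB; linarith
  simp [quadForm]
  rw [hV3, hB1]
  field_simp
  ring

lemma not_isBounded_of_coords_three_pos (hF : IsFrame F) {z : ℂ}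
    (hz : z ∈ (⋃ j, closure (tripleOfFrame F j))ᶜ) (h3 : 0 < coords F z 3) :
    ¬ Bornology.IsBounded (connectedComponentIn (⋃ j, closure (tripleOfFrame F j))ᶜ z) := by
  intro hb
  set B := Fᵀ 3 with hBdef
  have hB : lorentz B B = 1 := hF.lorentz_self 3
  have hk : 0 < B 0 := hF.pos
  set o : ℂ := ⟨B 1 / B 0, B 2 / B 0⟩ with ho
  have hray : ∀ t : ℝ, 1 ≤ t → o + t * (z - o) ∈ (⋃ j, closure (tripleOfFrame F j))ᶜ := by
    intro t ht
    have ht' : 0 ≤ t - 1 := by linarith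
    have hn : 0 ≤ t * (quadForm B z / B 0) + (t - 1) / B 0 ^ 2 := by
      have : 0 < quadForm B z := h3
      positivity
    rw [hF.compl_iUnion_closure] at hz ⊢
    have key : ∀ j : Fin 3, 0 < coords F z j.castSucc →
        0 < coords F (o + t * (z - o)) j.castSucc := by
      intro j hj
      have horth : lorentz (Fᵀ j.castSucc) B = 0 := by
        rw [hBdef, hF.lorentz_eq_gramMat]
        fin_cases j <;> rfl
      have h0 : 0 ≤ (Fᵀ j.castSucc) 0 := hF.nonneg j
      have hj' : 0 < quadForm (Fᵀ j.castSucc) z := hj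
      change 0 < quadForm (Fᵀ j.castSucc) (o + t * (z - o))
      rw [ho, quadForm_ray hB horth hk.ne' z t]
      positivity
    exact ⟨key 0 hz.1, key 1 hz.2.1, key 2 hz.2.2⟩
  have hsub : (fun t : ℝ => o + t * (z - o)) '' Set.Ici 1 ⊆
      connectedComponentIn (⋃ j, closure (tripleOfFrame F j))ᶜ z := by
    refine IsPreconnected.subset_connectedComponentIn ?_ ⟨1, by simp, by simp⟩ ?_
    · exact (convex_Ici 1).isPreconnected.image _ (by fun_prop)
    · rintro _ ⟨t, ht, rfl⟩
      exact hray t ht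
  have hzo : z - o ≠ 0 := by
    intro h
    have hzo : z = o := sub_eq_zero.1 h
    have h3' : 0 < quadForm B z := h3
    have : z ∈ genDisk B := by
      rw [genDisk_eq_ball hB hk, hzo]
      exact Metric.mem_ball_self (inv_pos.2 hk)
    exact lt_asymm this h3'
  obtain ⟨R, hR⟩ := (hb.subset hsub).subset_closedBall o
  have hR1 := hR ⟨1, by simp, rfl⟩
  have hn : 0 < ‖z - o‖ := norm_pos_iff.2 hzo
  have hR0 : 0 ≤ R := by
    simp only [Metric.mem_closedBall] at hR1
    exact dist_nonneg.trans hR1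
  have h2 := hR ⟨R / ‖z - o‖ + 1, by simp; positivity, rfl⟩
  simp only [Metric.mem_closedBall, dist_eq_norm, add_sub_cancel_left, norm_mul, Complex.norm_real,
    Real.norm_eq_abs] at h2
  rw [abs_of_nonneg (by positivity), add_mul, div_mul_cancel₀ _ hn.ne'] at h2
  linarith

lemma idealTriangle_eq (hF : IsFrame F) : idealTriangle (tripleOfFrame F) = openTri F := by
  obtain ⟨z, hz⟩ := hF.openTri_nonempty
  obtain ⟨hb, y, hy, hT⟩ := Classical.epsilon_spec (p := fun T : Set ℂ => Bornology.IsBounded T ∧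
    ∃ z ∈ (⋃ j, closure (tripleOfFrame F j))ᶜ,
      T = connectedComponentIn (⋃ j, closure (tripleOfFrame F j))ᶜ z)
    ⟨openTri F, hF.isBounded_openTri, z, hF.openTri_subset_compl hz,
      (hF.connectedComponentIn_eq_openTri hz).symm⟩
  change idealTriangle (tripleOfFrame F) = _ at hT
  change Bornology.IsBounded (idealTriangle (tripleOfFrame F)) at hb
  rw [hT] at hb ⊢
  have hy3 : coords F y 3 < 0 := by
    rcases lt_or_gt_of_ne (hF.coords_three_ne_zero hy) with h | h
    · exact h
    · exact absurd hb (hF.not_isBounded_of_coords_three_pos hy h)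
  refine hF.connectedComponentIn_eq_openTri ?_
  rw [hF.compl_iUnion_closure] at hy
  exact ⟨hy.1, hy.2.1, hy.2.2, hy3, hF.polar_self y⟩

end IsFrame

/-- The coefficients of the inscribed disk with respect to the columns of a frame. -/
def inCoeff : Fin 4 → ℝ := ![1, 1, 1, 2]

lemma quadForm_mulVec (F : Matrix (Fin 4) (Fin 4) ℝ) (c : Fin 4 → ℝ) (w : ℂ) :
    quadForm (F *ᵥ c) w = coords F w ⬝ᵥ c := by
  simp [quadForm, coords, mulVec, dotProduct, Fin.sum_univ_four]
  ring

lemma dotProduct_inCoeff (x : Fin 4 → ℝ) : x ⬝ᵥ inCoeff = x 0 + x 1 + x 2 + 2 * x 3 := by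
  simp [inCoeff, dotProduct, Fin.sum_univ_four]; ring

lemma Mmat_transpose_mul_gramMat_mul (j : Fin 3) : (Mmat j)ᵀ * gramMat * Mmat j = gramMat := by
  ext a b
  fin_cases j <;> fin_cases a <;> fin_cases b <;>
    simp [Mmat, gramMat, Matrix.mul_apply, Fin.sum_univ_four] <;> norm_num

lemma Mmat_nonneg (j : Fin 3) (a b : Fin 4) : 0 ≤ Mmat j a b := by
  fin_cases j <;> fin_cases a <;> fin_cases b <;> simp [Mmat]

lemma Mmat_three_three (j : Fin 3) : Mmat j 3 3 = 1 := by
  fin_cases j <;> rfl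

lemma Mmat_col_self (j : Fin 3) : (Mmat j)ᵀ j.castSucc = inCoeff := by
  ext a
  fin_cases j <;> fin_cases a <;> simp [Mmat, inCoeff]

lemma Mmat_col_of_ne {j k : Fin 3} (h : k ≠ j) :
    (Mmat j)ᵀ k.castSucc = Pi.single k.castSucc 1 := by
  ext a
  fin_cases j <;> fin_cases k <;> first | exact absurd rfl h | skip
  all_goals fin_cases a <;> simp [Mmat]

lemma transpose_mul_apply (F M : Matrix (Fin 4) (Fin 4) ℝ) (k : Fin 4) :
    (F * M)ᵀ k = F *ᵥ Mᵀ k := rfl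

namespace IsFrame

variable {F F' : Matrix (Fin 4) (Fin 4) ℝ}

lemma lorentz_mulVec (hF : IsFrame F) (c c' : Fin 4 → ℝ) :
    lorentz (F *ᵥ c) (F *ᵥ c') = c ⬝ᵥ (gramMat *ᵥ c') := by
  rw [lorentz_eq, ← hF.gram_eq, ← mulVec_mulVec, ← mulVec_mulVec, dotProduct_mulVec _ Fᵀ,
    vecMul_transpose]

lemma lorentz_inCoeff_self (hF : IsFrame F) : lorentz (F *ᵥ inCoeff) (F *ᵥ inCoeff) = 1 := by
  rw [hF.lorentz_mulVec]
  simp [inCoeff, gramMat, dotProduct, Fin.sum_univ_four]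
  norm_num

lemma lorentz_inCoeff_col (hF : IsFrame F) (j : Fin 3) :
    lorentz (F *ᵥ inCoeff) (Fᵀ j.castSucc) = -1 := by
  rw [show Fᵀ j.castSucc = F *ᵥ Pi.single j.castSucc 1 from (mulVec_single_one F _).symm,
    hF.lorentz_mulVec]
  fin_cases j <;>
    simp [inCoeff, gramMat, dotProduct, Fin.sum_univ_four]

lemma inCoeff_pos (hF : IsFrame F) : 0 < (F *ᵥ inCoeff) 0 := by
  change 0 < F 0 ⬝ᵥ inCoeff
  rw [dotProduct_inCoeff]
  linarith [hF.nonneg0, hF.nonneg1, hF.nonneg2, hF.pos]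

lemma eq_inCoeff_or (hF : IsFrame F) {V : Fin 4 → ℝ} (hV : lorentz V V = 1)
    (h : ∀ j : Fin 3, lorentz V (Fᵀ j.castSucc) = -1) :
    V = F *ᵥ inCoeff ∨ V = F *ᵥ ![1, 1, 1, -2] := by
  set c := lorentz V (Fᵀ 3)
  have hp : Fᵀ *ᵥ (lorentzMat *ᵥ V) = ![-1, -1, -1, c] := by
    ext j
    change Fᵀ j ⬝ᵥ (lorentzMat *ᵥ V) = _
    rw [← lorentz_eq, lorentz_comm]
    fin_cases j
    · exact h 0
    · exact h 1
    · exact h 2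
    · rfl
  have hVc : V = F *ᵥ ![1, 1, 1, c] := by
    have h1 : V = F *ᵥ (gramInv *ᵥ (Fᵀ *ᵥ (lorentzMat *ᵥ V))) := by
      simp only [mulVec_mulVec, ← Matrix.mul_assoc]
      rw [hF.dual, mul_eq_one_comm.1 lorentzMat_mul_lorentzInv, one_mulVec]
    rw [hp] at h1
    rw [h1]
    congr 1
    ext j
    fin_cases j <;> simp [gramInv] <;> norm_num
  rw [hVc, hF.lorentz_mulVec] at hV
  simp [gramMat, dotProduct, Fin.sum_univ_four] at hV
  have hc : (c - 2) * (c + 2) = 0 := by linarith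
  rcases mul_eq_zero.1 hc with hc | hc
  · left
    rw [hVc, show c = 2 by linarith]
    rfl
  · right
    rw [hVc, show c = -2 by linarith]

lemma genDisk_inCoeff_subset (hF : IsFrame F) : genDisk (F *ᵥ inCoeff) ⊆ openTri F := by
  intro w hw
  have hw' : quadForm (F *ᵥ inCoeff) w < 0 := hw
  have key : ∀ j : Fin 3, 0 < coords F w j.castSucc := by
    intro j
    have hk : 0 < (F *ᵥ inCoeff) 0 + Fᵀ j.castSucc 0 := add_pos_of_pos_of_nonneg hF.inCoeff_pos
      (hF.nonneg j)
    have := quadForm_add_eq hF.lorentz_inCoeff_self (hF.lorentz_self j.castSucc)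
      (hF.lorentz_inCoeff_col j) hk.ne' w
    have h2 : 0 ≤ quadForm (F *ᵥ inCoeff) w + quadForm (Fᵀ j.castSucc) w := by
      rw [this]; positivity
    change 0 < quadForm (Fᵀ j.castSucc) w
    linarith
  have h0 := key 0
  have h1 := key 1
  have h2 := key 2
  rw [quadForm_mulVec, dotProduct_inCoeff] at hw'
  simp only [Fin.castSucc_zero, Fin.castSucc_one] at h0 h1
  change 0 < coords F w 2 at h2
  exact (hF.mem_openTri_iff w).2 ⟨h0, h1, h2, by linarith⟩

lemma isInscribedDisk_inCoeff (hF : IsFrame F) :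
    IsInscribedDisk (tripleOfFrame F) (genDisk (F *ᵥ inCoeff)) := by
  refine ⟨isOpenDisk_genDisk hF.lorentz_inCoeff_self hF.inCoeff_pos, ?_, fun j => ?_⟩
  · rw [hF.idealTriangle_eq]
    exact hF.genDisk_inCoeff_subset
  · exact ⟨_, closure_inter_closure_genDisk hF.lorentz_inCoeff_self (hF.lorentz_self _)
      (hF.lorentz_inCoeff_col j) (add_pos_of_pos_of_nonneg hF.inCoeff_pos (hF.nonneg j))⟩

lemma Din_eq (hF : IsFrame F) : Din (tripleOfFrame F) = genDisk (F *ᵥ inCoeff) := by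
  obtain ⟨hD, hsub, ht⟩ := Classical.epsilon_spec (p := IsInscribedDisk (tripleOfFrame F))
    ⟨_, hF.isInscribedDisk_inCoeff⟩
  change IsOpenDisk (Din (tripleOfFrame F)) at hD
  change Din (tripleOfFrame F) ⊆ _ at hsub
  change ∀ j, ∃ p, closure (Din (tripleOfFrame F)) ∩ _ = {p} at ht
  obtain ⟨V, hV, hk, hDV⟩ := exists_genDisk_of_isOpenDisk hD
  rw [hDV] at hsub ht ⊢
  rw [hF.idealTriangle_eq] at hsub
  have hl : ∀ j : Fin 3, lorentz V (Fᵀ j.castSucc) = -1 := fun j =>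
    lorentz_eq_neg_one_of_tangent hV (hF.lorentz_self _) (ht j).choose_spec
  rcases hF.eq_inCoeff_or hV hl with h | h
  · rw [h]
  · exfalso
    have hmem : (⟨V 1 / V 0, V 2 / V 0⟩ : ℂ) ∈ genDisk V := by
      rw [genDisk_eq_ball hV hk]
      exact Metric.mem_ball_self (inv_pos.2 hk)
    obtain ⟨h0, h1, h2, h3, -⟩ := hsub hmem
    have hneg : quadForm V ⟨V 1 / V 0, V 2 / V 0⟩ < 0 := hmem
    rw [h, quadForm_mulVec, ← h] at hneg
    simp [dotProduct, Fin.sum_univ_four] at hneg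
    linarith

lemma mul_Mmat (hF : IsFrame F) (j : Fin 3) : IsFrame (F * Mmat j) where
  gram_eq := by
    rw [transpose_mul]
    calc (Mmat j)ᵀ * Fᵀ * lorentzMat * (F * Mmat j)
        = (Mmat j)ᵀ * (Fᵀ * lorentzMat * F) * Mmat j := by simp only [Matrix.mul_assoc]
      _ = gramMat := by rw [hF.gram_eq, Mmat_transpose_mul_gramMat_mul]
  nonneg k := by
    have h3 := hF.pos.le
    have := mul_nonneg hF.nonneg0 (Mmat_nonneg j 0 k.castSucc)
    have := mul_nonneg hF.nonneg1 (Mmat_nonneg j 1 k.castSucc)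
    have := mul_nonneg hF.nonneg2 (Mmat_nonneg j 2 k.castSucc)
    have := mul_nonneg h3 (Mmat_nonneg j 3 k.castSucc)
    simp only [Matrix.mul_apply, Fin.sum_univ_four]
    linarith
  pos := by
    have := mul_nonneg hF.nonneg0 (Mmat_nonneg j 0 3)
    have := mul_nonneg hF.nonneg1 (Mmat_nonneg j 1 3)
    have := mul_nonneg hF.nonneg2 (Mmat_nonneg j 2 3)
    simp only [Matrix.mul_apply, Fin.sum_univ_four, Mmat_three_three]
    linarith [hF.pos]

lemma Phi_eq (hF : IsFrame F) (j : Fin 3) :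
    Phi j (tripleOfFrame F) = tripleOfFrame (F * Mmat j) := by
  funext k
  rcases eq_or_ne k j with rfl | h
  · rw [Phi, Function.update_self, hF.Din_eq, tripleOfFrame, transpose_mul_apply, Mmat_col_self]
  · rw [Phi, Function.update_of_ne h, tripleOfFrame, tripleOfFrame, transpose_mul_apply,
      Mmat_col_of_ne h, mulVec_single_one]
    rfl

lemma mul_Mword (hF : IsFrame F) (w : Word) : IsFrame (F * Mword w) := by
  induction w generalizing F with
  | nil => simpa [Mword] using hF
  | cons j w ih =>
    have := ih (hF.mul_Mmat j)
    rwa [Matrix.mul_assoc] at this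

lemma applyWord_eq (hF : IsFrame F) (w : Word) :
    applyWord (tripleOfFrame F) w = tripleOfFrame (F * Mword w) := by
  induction w generalizing F with
  | nil => simp [Mword, applyWord]
  | cons j w ih =>
    have := ih (hF.mul_Mmat j)
    rw [Matrix.mul_assoc, ← hF.Phi_eq] at this
    exact this

lemma AG_eq (hF : IsFrame F) : AG (tripleOfFrame F) = closure (openTri F) \
    {z | ∃ w : Word, (coords F z ᵥ* Mword w) ⬝ᵥ inCoeff < 0} := by
  have h : ∀ w : Word, Din (applyWord (tripleOfFrame F) w) =
      {z | (coords F z ᵥ* Mword w) ⬝ᵥ inCoeff < 0} := by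
    intro w
    rw [hF.applyWord_eq, (hF.mul_Mword w).Din_eq]
    ext z
    change quadForm _ z < 0 ↔ _
    rw [quadForm_mulVec, coords_mul]
    rfl
  rw [AG, hF.idealTriangle_eq]
  congr 1
  ext z
  simp only [Set.mem_iUnion, h]
  rfl

lemma AG_subset_closedTri (hF : IsFrame F) : AG (tripleOfFrame F) ⊆ closedTri F := by
  rw [hF.AG_eq]
  exact fun z hz => hF.closure_openTri_subset hz.1

lemma AG_subset_image (hF : IsFrame F) (hF' : IsFrame F') :
    AG (tripleOfFrame F') ⊆ (fun w => point F' (coords F w)) '' AG (tripleOfFrame F) := by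
  intro z hz
  have hzt := hF'.AG_subset_closedTri hz
  refine ⟨point F (coords F' z), ?_, hF'.transition_transition hF hzt⟩
  rw [hF'.AG_eq] at hz
  rw [hF.AG_eq]
  refine ⟨hF'.transition_mem_closure hF hz.1, ?_⟩
  rintro ⟨w, hw⟩
  refine hz.2 ⟨w, ?_⟩
  have hpos := inv_pos.2 (hF.dotProduct_weight_pos hzt)
  rw [hF'.coords_transition hF hzt, smul_vecMul, smul_dotProduct, smul_eq_mul] at hw
  exact (pos_iff_neg_of_mul_neg hw).1 hpos

lemma hausdorffMeasure_AG_le (hF : IsFrame F) (hF' : IsFrame F') {c : ℝ} (hc : 0 < c)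
    (h : ∀ x ∈ triCone, F 0 ⬝ᵥ weight x ≤ c * (F' 0 ⬝ᵥ weight x)) {s : ℝ} (hs : 0 ≤ s) :
    μH[s] (AG (tripleOfFrame F')) ≤ ENNReal.ofReal c ^ s * μH[s] (AG (tripleOfFrame F)) := by
  have hL : LipschitzOnWith c.toNNReal (fun w => point F' (coords F w)) (AG (tripleOfFrame F)) := by
    refine LipschitzOnWith.of_dist_le_mul fun z hz z' hz' => ?_
    rw [Real.coe_toNNReal _ hc.le]
    exact hF.dist_transition_le hF' hc h (hF.AG_subset_closedTri hz) (hF.AG_subset_closedTri hz')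
  exact (measure_mono (hF.AG_subset_image hF')).trans (hL.hausdorffMeasure_image_le hs)

end IsFrame

lemma isFrame_of_lorentz {V : Fin 4 → Fin 4 → ℝ}
    (h0 : lorentz (V 0) (V 0) = 1) (h1 : lorentz (V 1) (V 1) = 1) (h2 : lorentz (V 2) (V 2) = 1)
    (h3 : lorentz (V 3) (V 3) = 1) (h01 : lorentz (V 0) (V 1) = -1)
    (h12 : lorentz (V 1) (V 2) = -1) (h20 : lorentz (V 2) (V 0) = -1)
    (h03 : lorentz (V 0) (V 3) = 0) (h13 : lorentz (V 1) (V 3) = 0)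
    (h23 : lorentz (V 2) (V 3) = 0) (hn : ∀ j : Fin 3, 0 ≤ V j.castSucc 0) (hp : 0 < V 3 0) :
    IsFrame (Matrix.of V)ᵀ where
  gram_eq := by
    ext i j
    rw [← lorentz_col, transpose_transpose]
    change lorentz (V i) (V j) = _
    fin_cases i <;> fin_cases j <;>
      simp [gramMat, h0, h1, h2, h3, h01, h12, h20, h03, h13, h23, lorentz_comm (V 1) (V 0),
        lorentz_comm (V 2) (V 1), lorentz_comm (V 0) (V 2), lorentz_comm (V 3)]
  nonneg := hn
  pos := hp

namespace IsFrame

variable {F : Matrix (Fin 4) (Fin 4) ℝ}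

lemma add_pos (hF : IsFrame F) {j k : Fin 3} (h : j ≠ k) :
    0 < F 0 j.castSucc + F 0 k.castSucc := by
  refine (add_nonneg (hF.nonneg j) (hF.nonneg k)).lt_of_ne fun hc => ?_
  have hj : F 0 j.castSucc = 0 := by linarith [hF.nonneg j, hF.nonneg k]
  have hk : F 0 k.castSucc = 0 := by linarith [hF.nonneg j, hF.nonneg k]
  have hs : 0 < F 0 0 * F 0 1 + F 0 1 * F 0 2 + F 0 2 * F 0 0 := by
    rw [← hF.curv_sq]
    exact pow_pos hF.pos 2
  fin_cases j <;> fin_cases k <;> first | exact h rfl | skip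
  all_goals
    simp at hj hk
    simp [hj, hk] at hs

lemma lorentz_col_of_ne (hF : IsFrame F) {j k : Fin 3} (h : j ≠ k) :
    lorentz (Fᵀ j.castSucc) (Fᵀ k.castSucc) = -1 := by
  rw [hF.lorentz_eq_gramMat]
  fin_cases j <;> fin_cases k <;> first | exact absurd rfl h | rfl

lemma curv_tripleOfFrame (hF : IsFrame F) (j : Fin 3) :
    curv (tripleOfFrame F j) = F 0 j.castSucc :=
  curv_genDisk (hF.lorentz_self _) (hF.nonneg j)

lemma closure_inter_closure (hF : IsFrame F) {j k : Fin 3} (h : j ≠ k) :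
    closure (tripleOfFrame F j) ∩ closure (tripleOfFrame F k) =
      {⟨(F 1 j.castSucc + F 1 k.castSucc) / (F 0 j.castSucc + F 0 k.castSucc),
        (F 2 j.castSucc + F 2 k.castSucc) / (F 0 j.castSucc + F 0 k.castSucc)⟩} :=
  closure_inter_closure_genDisk (hF.lorentz_self _) (hF.lorentz_self _)
    (hF.lorentz_col_of_ne h) (hF.add_pos h)

lemma isTDT (hF : IsFrame F) : IsTDT (tripleOfFrame F) := by
  refine ⟨?_, fun j k h => ⟨_, hF.closure_inter_closure h⟩⟩
  by_cases h : ∀ j : Fin 3, 0 < F 0 j.castSucc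
  · exact Or.inl fun j => isOpenDisk_genDisk (hF.lorentz_self _) (h j)
  · push Not at h
    obtain ⟨j, hj⟩ := h
    have hj' : F 0 j.castSucc = 0 := le_antisymm hj (hF.nonneg j)
    refine Or.inr ⟨j, isOpenHalfPlane_genDisk (hF.lorentz_self _) hj', fun k hk =>
      isOpenDisk_genDisk (hF.lorentz_self _) ?_⟩
    have := hF.add_pos hk
    change 0 < F 0 k.castSucc
    linarith

lemma tangencyPoint_eq (hF : IsFrame F) (j : Fin 3) : tangencyPoint (tripleOfFrame F) j =
    ⟨(F 1 (j + 1).castSucc + F 1 (j + 2).castSucc) /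
        (F 0 (j + 1).castSucc + F 0 (j + 2).castSucc),
      (F 2 (j + 1).castSucc + F 2 (j + 2).castSucc) /
        (F 0 (j + 1).castSucc + F 0 (j + 2).castSucc)⟩ := by
  have h : j + 1 ≠ j + 2 := by simp
  have hs := Classical.epsilon_spec (p := fun p : ℂ =>
    closure (tripleOfFrame F (j + 1)) ∩ closure (tripleOfFrame F (j + 2)) = {p})
    ⟨_, hF.closure_inter_closure h⟩
  change _ = {tangencyPoint (tripleOfFrame F) j} at hs
  rw [hF.closure_inter_closure h] at hs
  exact (Set.singleton_eq_singleton_iff.1 hs).symm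

end IsFrame

lemma sq_of_mem_Gamma {g : Fin 4 → ℝ} (hg : g ∈ Gamma) :
    g 3 ^ 2 = g 1 * g 2 + g 2 * g 0 + g 0 * g 1 := by
  obtain ⟨h0, h1, h2, h3, -⟩ := hg
  rw [h3, kappa, Real.sq_sqrt (by positivity)]

lemma add_pos_of_mem_Gamma {g : Fin 4 → ℝ} (hg : g ∈ Gamma) :
    0 < g 0 + g 1 ∧ 0 < g 1 + g 2 ∧ 0 < g 2 + g 0 := by
  have hs := sq_of_mem_Gamma hg
  obtain ⟨h0, h1, h2, -, h3⟩ := hg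
  have h3 : 0 < g 1 * g 2 + g 2 * g 0 + g 0 * g 1 := hs ▸ pow_pos h3 2
  refine ⟨?_, ?_, ?_⟩ <;>
  · by_contra hc
    nlinarith

/-- An explicit frame with prescribed curvatures. -/
noncomputable def stdFrame (g : Fin 4 → ℝ) : Matrix (Fin 4) (Fin 4) ℝ :=
  (Matrix.of ![![g 0, g 0 / g 3, -1, g 0 / g 3 ^ 2],
    ![g 1, g 1 / g 3, 1, g 1 / g 3 ^ 2],
    ![g 2, g 2 / g 3 - 2 * g 3 / (g 0 + g 1), (g 1 - g 0) / (g 0 + g 1), g 2 / g 3 ^ 2],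
    ![g 3, 0, 0, -1 / g 3]])ᵀ

lemma isFrame_stdFrame {g : Fin 4 → ℝ} (hg : g ∈ Gamma) : IsFrame (stdFrame g) := by
  have hs := sq_of_mem_Gamma hg
  obtain ⟨hK, -, -⟩ := add_pos_of_mem_Gamma hg
  obtain ⟨h0, h1, h2, -, h3⟩ := hg
  have h3' := h3.ne'
  have hK' := hK.ne'
  refine isFrame_of_lorentz ?_ ?_ ?_ ?_ ?_ ?_ ?_ ?_ ?_ ?_ ?_ ?_
  all_goals simp [lorentz]
  · field_simp
    ring
  · field_simp
    ring
  · field_simp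
    linear_combination 8 * g 3 ^ 2 * hs
  · field_simp
    ring
  · field_simp
    ring
  · field_simp
    ring
  · field_simp
    ring
  · field_simp
    ring
  · field_simp
    ring
  · field_simp
    ring
  · intro j
    fin_cases j <;> simpa
  · exact h3

lemma isTDTplus_stdFrame {g : Fin 4 → ℝ} (hg : g ∈ Gamma) :
    IsTDTplus (tripleOfFrame (stdFrame g)) := by
  have hF := isFrame_stdFrame hg
  refine ⟨hF.isTDT, ?_⟩
  obtain ⟨hK, hP, hQ⟩ := add_pos_of_mem_Gamma hg
  have h3 := hg.2.2.2.2
  have h3' := h3.ne'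
  have hK' := hK.ne'
  have hP' := hP.ne'
  have hQ' := hQ.ne'
  have e : 0 < 4 * g 3 / ((g 0 + g 1) * (g 1 + g 2) * (g 2 + g 0)) := by positivity
  have e20 : (2 : Fin 3) + 1 = 0 := rfl
  have e21 : (2 : Fin 3) + 2 = 1 := rfl
  have e10 : (1 : Fin 3) + 1 = 2 := rfl
  have e11 : (1 : Fin 3) + 2 = 0 := rfl
  rw [hF.tangencyPoint_eq, hF.tangencyPoint_eq, hF.tangencyPoint_eq]
  simp only [e20, e21, e10, e11, zero_add]
  have c2 : (2 : Fin 3).castSucc = 2 := rfl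
  simp only [c2, Fin.castSucc_zero, Fin.castSucc_one]
  refine e.trans_eq ?_
  simp [stdFrame]
  field_simp
  ring

/-- Three mutually tangent generalized disks have a dual disk. -/
lemma exists_dual {V W U : Fin 4 → ℝ} {k : ℝ} (hV : lorentz V V = 1) (hW : lorentz W W = 1)
    (hU : lorentz U U = 1) (hVW : lorentz V W = -1) (hVU : lorentz V U = -1)
    (hWU : lorentz W U = -1) (hK : V 0 + W 0 ≠ 0)
    (hk : k ^ 2 = W 0 * U 0 + U 0 * V 0 + V 0 * W 0) :
    ∃ B : Fin 4 → ℝ, B 0 = k ∧ lorentz B B = 1 ∧ lorentz V B = 0 ∧ lorentz W B = 0 ∧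
      lorentz U B = 0 := by
  have hq := quadForm_tangency_left hV hW hVW hK
  have hq' := quadForm_tangency_left hW hV (by rwa [lorentz_comm]) (by rwa [add_comm])
  rw [add_comm (W 0), add_comm (W 1), add_comm (W 2)] at hq'
  set q1 := (V 1 + W 1) / (V 0 + W 0) with hq1
  set q2 := (V 2 + W 2) / (V 0 + W 0) with hq2
  have hs1 : W 1 = (V 0 + W 0) * q1 - V 1 := by rw [hq1]; field_simp; ring
  have hs2 : W 2 = (V 0 + W 0) * q2 - V 2 := by rw [hq2]; field_simp; ring
  obtain ⟨n1, hn1⟩ : ∃ n1, V 1 = V 0 * q1 + n1 := ⟨V 1 - V 0 * q1, by ring⟩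
  obtain ⟨n2, hn2⟩ : ∃ n2, V 2 = V 0 * q2 + n2 := ⟨V 2 - V 0 * q2, by ring⟩
  obtain ⟨m1, hm1⟩ : ∃ m1, U 1 = U 0 * q1 + m1 := ⟨U 1 - U 0 * q1, by ring⟩
  obtain ⟨m2, hm2⟩ : ∃ m2, U 2 = U 0 * q2 + m2 := ⟨U 2 - U 0 * q2, by ring⟩
  obtain ⟨h, hh⟩ : ∃ h, U 3 = U 0 * (q1 ^ 2 + q2 ^ 2) + 2 * (m1 * q1 + m2 * q2) + h :=
    ⟨_, (add_sub_cancel _ _).symm⟩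
  clear_value q1 q2
  simp only [quadForm] at hq hq'
  have hV3 : V 3 = V 0 * (q1 ^ 2 + q2 ^ 2) + 2 * (n1 * q1 + n2 * q2) := by
    rw [hn1, hn2] at hq; linarith
  have hW3 : W 3 = W 0 * (q1 ^ 2 + q2 ^ 2) - 2 * (n1 * q1 + n2 * q2) := by
    rw [hs1, hs2, hn1, hn2] at hq'; linarith
  rw [hn1] at hs1
  rw [hn2] at hs2
  have hnn : n1 ^ 2 + n2 ^ 2 = 1 := by
    rw [← hV]; unfold lorentz; rw [hn1, hn2, hV3]; ring
  have hVU' : n1 * m1 + n2 * m2 - V 0 * h / 2 = -1 := by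
    rw [← hVU]; unfold lorentz; rw [hn1, hn2, hV3, hm1, hm2, hh]; ring
  have hWU' : -(n1 * m1 + n2 * m2) - W 0 * h / 2 = -1 := by
    rw [← hWU]; unfold lorentz; rw [hs1, hs2, hW3, hm1, hm2, hh]; ring
  have hUU' : m1 ^ 2 + m2 ^ 2 - U 0 * h = 1 := by
    rw [← hU]; unfold lorentz; rw [hm1, hm2, hh]; ring
  have hKh : (V 0 + W 0) * h = 4 := by linarith
  have hc : (n1 * m2 - n2 * m1) ^ 2 = (k * h / 2) ^ 2 := by
    have e1 : (n1 * m2 - n2 * m1) ^ 2 = (n1 ^ 2 + n2 ^ 2) * (m1 ^ 2 + m2 ^ 2)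
        - (n1 * m1 + n2 * m2) ^ 2 := by ring
    rw [e1, hnn, show m1 ^ 2 + m2 ^ 2 = 1 + U 0 * h by linarith,
      show n1 * m1 + n2 * m2 = V 0 * h / 2 - 1 by linarith, div_pow, mul_pow, hk]
    linear_combination (-(U 0 * h / 4) - V 0 * h / 4) * hKh
  obtain ⟨s, hs, hsc⟩ : ∃ s : ℝ, s ^ 2 = 1 ∧ s * (n1 * m2 - n2 * m1) = k * h / 2 := by
    rcases sq_eq_sq_iff_eq_or_eq_neg.1 hc with e | e
    · exact ⟨1, by norm_num, by rw [e]; ring⟩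
    · exact ⟨-1, by norm_num, by rw [e]; ring⟩
  refine ⟨![k, k * q1 - s * n2, k * q2 + s * n1,
    k * (q1 ^ 2 + q2 ^ 2) + 2 * s * (-n2 * q1 + n1 * q2)], rfl, ?_, ?_, ?_, ?_⟩
  · simp [lorentz]
    linear_combination hnn + (n1 ^ 2 + n2 ^ 2) * hs
  · simp [lorentz, hn1, hn2, hV3]
    ring
  · simp [lorentz, hs1, hs2, hW3]
    ring
  · simp [lorentz, hm1, hm2, hh]
    linear_combination hsc

lemma IsTDT.exists_genDisk {𝒟 : Fin 3 → Set ℂ} (h𝒟 : IsTDT 𝒟) (j : Fin 3) :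
    ∃ V : Fin 4 → ℝ, lorentz V V = 1 ∧ 0 ≤ V 0 ∧ 𝒟 j = genDisk V := by
  have hd : IsOpenDisk (𝒟 j) → ∃ V : Fin 4 → ℝ, lorentz V V = 1 ∧ 0 ≤ V 0 ∧ 𝒟 j = genDisk V :=
    fun h => (exists_genDisk_of_isOpenDisk h).imp fun V hV => ⟨hV.1, hV.2.1.le, hV.2.2⟩
  rcases h𝒟.1 with h | ⟨i, hi, h⟩
  · exact hd (h j)
  · rcases eq_or_ne j i with rfl | hne
    · exact (exists_genDisk_of_isOpenHalfPlane hi).imp fun V hV => ⟨hV.1, hV.2.1.ge, hV.2.2⟩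
    · exact hd (h j hne)

lemma IsTDT.exists_isFrame {𝒟 : Fin 3 → Set ℂ} (h𝒟 : IsTDT 𝒟) {g : Fin 4 → ℝ} (hg : g ∈ Gamma)
    (hc : ∀ j : Fin 3, curv (𝒟 j) = g j.castSucc) :
    ∃ F, IsFrame F ∧ F 0 = g ∧ 𝒟 = tripleOfFrame F := by
  choose V hV hn hD using h𝒟.exists_genDisk
  have hVg : ∀ j, V j 0 = g j.castSucc := fun j => by
    rw [← hc, hD, curv_genDisk (hV j) (hn j)]
  have ht : ∀ j k, j ≠ k → lorentz (V j) (V k) = -1 := fun j k h => by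
    obtain ⟨p, hp⟩ := h𝒟.2 j k h
    rw [hD, hD] at hp
    exact lorentz_eq_neg_one_of_tangent (hV j) (hV k) hp
  have h0 : V 0 0 = g 0 := hVg 0
  have h1 : V 1 0 = g 1 := hVg 1
  have h2 : V 2 0 = g 2 := hVg 2
  obtain ⟨B, hBk, hB, hB0, hB1, hB2⟩ := exists_dual (k := g 3) (hV 0) (hV 1) (hV 2)
    (ht 0 1 (by decide)) (ht 0 2 (by decide)) (ht 1 2 (by decide))
    (by rw [h0, h1]; exact (add_pos_of_mem_Gamma hg).1.ne')
    (by rw [h0, h1, h2]; exact sq_of_mem_Gamma hg)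
  refine ⟨(Matrix.of ![V 0, V 1, V 2, B])ᵀ, isFrame_of_lorentz (hV 0) (hV 1) (hV 2) hB
    (ht 0 1 (by decide)) (ht 1 2 (by decide)) (ht 2 0 (by decide)) hB0 hB1 hB2 ?_ ?_, ?_, ?_⟩
  · intro j
    fin_cases j
    exacts [hn 0, hn 1, hn 2]
  · change 0 < B 0
    rw [hBk]
    exact hg.2.2.2.2
  · ext j
    fin_cases j
    exacts [h0, h1, h2, hBk]
  · funext j
    rw [hD]
    fin_cases j <;> rfl

/-- The triple with prescribed curvatures comes from a frame. -/
lemma exists_isFrame_tripleOf {g : Fin 4 → ℝ} (hg : g ∈ Gamma) :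
    ∃ F, IsFrame F ∧ F 0 = g ∧ tripleOf g = tripleOfFrame F := by
  have hF := isFrame_stdFrame hg
  obtain ⟨h, h0, h1, h2⟩ := Classical.epsilon_spec (p := fun 𝒟 : Fin 3 → Set ℂ =>
    IsTDTplus 𝒟 ∧ curv (𝒟 0) = g 0 ∧ curv (𝒟 1) = g 1 ∧ curv (𝒟 2) = g 2)
    ⟨_, isTDTplus_stdFrame hg, hF.curv_tripleOfFrame 0, hF.curv_tripleOfFrame 1,
      hF.curv_tripleOfFrame 2⟩
  refine h.1.exists_isFrame hg fun j => ?_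
  fin_cases j
  exacts [h0, h1, h2]

namespace IsFrame

variable {F : Matrix (Fin 4) (Fin 4) ℝ}

lemma openTri_mul_Mmat_subset (hF : IsFrame F) (j : Fin 3) : openTri (F * Mmat j) ⊆ openTri F := by
  intro z hz
  obtain ⟨h0, h1, h2, h3, -⟩ := hz
  rw [coords_mul] at h0 h1 h2 h3
  rw [hF.mem_openTri_iff]
  fin_cases j <;>
    simp [Mmat, vecMul, dotProduct, Fin.sum_univ_four] at h0 h1 h2 h3 <;>
    refine ⟨?_, ?_, ?_, ?_⟩ <;> linarith

lemma openTri_mul_Mword_subset (hF : IsFrame F) (w : Word) :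
    openTri (F * Mword w) ⊆ openTri F := by
  induction w generalizing F with
  | nil => simp [Mword]
  | cons j w ih =>
    have := ih (hF.mul_Mmat j)
    rw [Matrix.mul_assoc] at this
    exact this.trans (hF.openTri_mul_Mmat_subset j)

lemma mem_AG_of_coords_nonpos (hF : IsFrame F) {z : ℂ} (hz : z ∈ closure (openTri F))
    (h0 : coords F z 0 ≤ 0) : z ∈ AG (tripleOfFrame F) := by
  rw [hF.AG_eq]
  refine ⟨hz, ?_⟩
  rintro ⟨w, hw⟩
  have hin : z ∈ genDisk ((F * Mword w) *ᵥ inCoeff) := by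
    change quadForm _ z < 0
    rwa [quadForm_mulVec, coords_mul]
  exact h0.not_gt
    (hF.openTri_mul_Mword_subset w ((hF.mul_Mword w).genDisk_inCoeff_subset hin)).1

end IsFrame

/-- The frame of `baseTriple`. -/
noncomputable def baseFrame : Matrix (Fin 4) (Fin 4) ℝ :=
  (Matrix.of ![![0, 0, 1, 2], ![2, -1, 1, 1 / 2], ![2, 1, 1, 1 / 2], ![2, 0, 2, 3 / 2]])ᵀ

lemma isFrame_baseFrame : IsFrame baseFrame := by
  refine isFrame_of_lorentz ?_ ?_ ?_ ?_ ?_ ?_ ?_ ?_ ?_ ?_ ?_ ?_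
  on_goal 11 => intro j; fin_cases j
  all_goals simp [lorentz]
  all_goals norm_num

lemma tripleOfFrame_baseFrame : tripleOfFrame baseFrame = baseTriple := by
  have hball : ∀ j : Fin 3, 0 < baseFrame 0 j.castSucc → tripleOfFrame baseFrame j =
      Metric.ball ⟨baseFrame 1 j.castSucc / baseFrame 0 j.castSucc,
        baseFrame 2 j.castSucc / baseFrame 0 j.castSucc⟩ (baseFrame 0 j.castSucc)⁻¹ := fun j hj =>
    genDisk_eq_ball (isFrame_baseFrame.lorentz_self _) hj
  funext j
  fin_cases j
  · ext z
    simp [tripleOfFrame, genDisk, quadForm, baseFrame, baseTriple]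
  · refine (hball 1 (by simp [baseFrame])).trans ?_
    change _ = Metric.ball _ _
    congr 1
    · apply Complex.ext
      · simp [baseFrame]
        norm_num
      · simp [baseFrame]
    · simp [baseFrame]
  · refine (hball 2 (by simp [baseFrame])).trans ?_
    change _ = Metric.ball _ _
    congr 1
    · apply Complex.ext <;> simp [baseFrame]
    · simp [baseFrame]

lemma segment_subset_AG_baseTriple :
    (fun x : ℝ => (x : ℂ) + Complex.I) '' Set.Ioo (-1 / 2) (1 / 2) ⊆ AG baseTriple := by
  rintro _ ⟨x, ⟨hx1, hx2⟩, rfl⟩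
  rw [← tripleOfFrame_baseFrame]
  refine isFrame_baseFrame.mem_AG_of_coords_nonpos ?_ ?_
  · have hlim : Tendsto (fun t : ℝ => (x : ℂ) + Complex.I - t * Complex.I) (𝓝[>] 0)
        (𝓝 ((x : ℂ) + Complex.I)) := by
      have hc : Continuous fun t : ℝ => (x : ℂ) + Complex.I - t * Complex.I := by fun_prop
      have := (hc.tendsto 0).mono_left (nhdsWithin_le_nhds (s := Set.Ioi 0))
      simpa using this
    refine mem_closure_of_tendsto hlim ?_
    have hcoord : ∀ j, Tendsto
        (fun t : ℝ => coords baseFrame ((x : ℂ) + Complex.I - t * Complex.I) j)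
        (𝓝[>] 0) (𝓝 (coords baseFrame ((x : ℂ) + Complex.I) j)) := fun j =>
      ((continuous_quadForm _).tendsto _).comp hlim
    filter_upwards [self_mem_nhdsWithin,
      (hcoord 1).eventually_const_lt (u := 0) (by
        simp [coords, quadForm, baseFrame]; nlinarith),
      (hcoord 2).eventually_const_lt (u := 0) (by
        simp [coords, quadForm, baseFrame]; nlinarith),
      (hcoord 3).eventually_lt_const (u := 0) (by
        simp [coords, quadForm, baseFrame]; nlinarith)] with t h0 h1 h2 h3
    refine (isFrame_baseFrame.mem_openTri_iff _).2 ⟨?_, h1, h2, h3⟩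
    have : 0 < t := h0
    simp [coords, quadForm, baseFrame, this]
  · simp [coords, quadForm, baseFrame]

lemma one_le_dAG : 1 ≤ dAG := by
  have hiso : Isometry fun x : ℝ => (x : ℂ) + Complex.I :=
    (isometry_add_right Complex.I).comp Complex.isometry_ofReal
  have h1 : 1 ≤ dimH (AG baseTriple) := by
    refine le_trans ?_ (dimH_mono segment_subset_AG_baseTriple)
    rw [hiso.dimH_image, Real.dimH_of_nonempty_interior]
    · simp
    · rw [interior_Ioo]
      exact ⟨0, by norm_num, by norm_num⟩
  simpa [dAG] using ENNReal.toReal_mono (Real.dimH_ne_top _) h1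

lemma IsFrame.row_mem_Gamma {F : Matrix (Fin 4) (Fin 4) ℝ} (hF : IsFrame F) : F 0 ∈ Gamma := by
  refine ⟨hF.nonneg0, hF.nonneg1, hF.nonneg2, ?_, hF.pos⟩
  rw [kappa, show F 0 1 * F 0 2 + F 0 2 * F 0 0 + F 0 0 * F 0 1 = F 0 3 ^ 2 by
    rw [hF.curv_sq]; ring, Real.sqrt_sq hF.pos.le]

lemma vecMul_Mword_mem_Gamma {g : Fin 4 → ℝ} (hg : g ∈ Gamma) (w : Word) :
    g ᵥ* Mword w ∈ Gamma := by
  obtain ⟨F, hF, rfl, -⟩ := exists_isFrame_tripleOf hg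
  exact (hF.mul_Mword w).row_mem_Gamma

lemma smul_mem_Gamma {g : Fin 4 → ℝ} (hg : g ∈ Gamma) {s : ℝ} (hs : 0 < s) : s • g ∈ Gamma := by
  obtain ⟨h0, h1, h2, h3, h4⟩ := hg
  refine ⟨mul_nonneg hs.le h0, mul_nonneg hs.le h1, mul_nonneg hs.le h2, ?_, mul_pos hs h4⟩
  simp only [Pi.smul_apply, smul_eq_mul, h3, kappa]
  rw [show s * g 1 * (s * g 2) + s * g 2 * (s * g 0) + s * g 0 * (s * g 1) =
    s ^ 2 * (g 1 * g 2 + g 2 * g 0 + g 0 * g 1) by ring, Real.sqrt_mul (by positivity),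
    Real.sqrt_sq hs.le]

/-- Comparison of the Hausdorff measures of two gaskets from a comparison of their curvatures. -/
lemma HGamma_rpow_le {g g' : Fin 4 → ℝ} (hg : g ∈ Gamma) (hg' : g' ∈ Gamma) {c c' : ℝ}
    (hc : 0 < c) (hc' : 0 < c') (h : ∀ x ∈ triCone, g ⬝ᵥ weight x ≤ c * (g' ⬝ᵥ weight x))
    (h' : ∀ x ∈ triCone, g' ⬝ᵥ weight x ≤ c' * (g ⬝ᵥ weight x)) :
    HGamma g' ^ (1 / dAG) ≤ c * HGamma g ^ (1 / dAG) := by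
  obtain ⟨F, hF, rfl, hFt⟩ := exists_isFrame_tripleOf hg
  obtain ⟨F', hF', rfl, hFt'⟩ := exists_isFrame_tripleOf hg'
  have hd : 0 < dAG := zero_lt_one.trans_le one_le_dAG
  have hle := hF.hausdorffMeasure_AG_le hF' hc h hd.le
  have hle' := hF'.hausdorffMeasure_AG_le hF hc' h' hd.le
  rw [← hFt, ← hFt'] at hle hle'
  by_cases htop : μH[dAG] (AG (tripleOf (F 0))) = ⊤
  · have htop' : μH[dAG] (AG (tripleOf (F' 0))) = ⊤ := by
      by_contra hne
      exact (ENNReal.mul_ne_top (ENNReal.rpow_ne_top_of_nonneg hd.le ENNReal.ofReal_ne_top) hne)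
        (top_le_iff.1 (htop ▸ hle'))
    simp [HGamma, htop, htop', Real.zero_rpow, hd.ne']
  · have hreal : HGamma (F' 0) ≤ c ^ dAG * HGamma (F 0) := by
      have := ENNReal.toReal_mono (ENNReal.mul_ne_top
        (ENNReal.rpow_ne_top_of_nonneg hd.le ENNReal.ofReal_ne_top) htop) hle
      rwa [ENNReal.toReal_mul, ← ENNReal.toReal_rpow, ENNReal.toReal_ofReal hc.le] at this
    have hn : ∀ g, 0 ≤ HGamma g := fun g => ENNReal.toReal_nonneg
    calc HGamma (F' 0) ^ (1 / dAG) ≤ (c ^ dAG * HGamma (F 0)) ^ (1 / dAG) :=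
          Real.rpow_le_rpow (hn _) hreal (by positivity)
      _ = c * HGamma (F 0) ^ (1 / dAG) := by
          rw [Real.mul_rpow (by positivity) (hn _), ← Real.rpow_mul hc.le,
            mul_one_div_cancel hd.ne', Real.rpow_one]

/-- A cone containing the weights of points of ideal triangles and preserved by the matrices
`Mmat j`, on which the elements of `GammaEps ε` are bounded below. -/
def weightCone : Set (Fin 4 → ℝ) :=
  {u | 0 ≤ u 0 ∧ 0 ≤ u 1 ∧ 0 ≤ u 2 ∧ 0 ≤ u 3 ∧ u 0 ≤ 2 * (u 1 + u 2) ∧ u 1 ≤ 2 * (u 2 + u 0) ∧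
    u 2 ≤ 2 * (u 0 + u 1) ∧ u 3 ≤ u 0 + u 1 + u 2}

lemma weight_mem_weightCone {x : Fin 4 → ℝ} (hx : x ∈ triCone) : weight x ∈ weightCone := by
  obtain ⟨h0, h1, h2, h3, h4, -⟩ := hx
  have hB : -x 3 ≤ x 0 + x 1 + x 2 := by
    refine abs_le_of_sq_le_sq' ?_ (by positivity) |>.2
    unfold polar at h4
    nlinarith [mul_nonneg h0 h1, mul_nonneg h1 h2, mul_nonneg h2 h0, sq_nonneg (x 0),
      sq_nonneg (x 1), sq_nonneg (x 2)]
  simp only [weightCone, weight, Set.mem_ofPred_eq, Matrix.cons_val]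
  refine ⟨?_, ?_, ?_, ?_, ?_, ?_, ?_, ?_⟩ <;> linarith

lemma Mmat_mulVec_mem_weightCone (j : Fin 3) {u : Fin 4 → ℝ} (hu : u ∈ weightCone) :
    Mmat j *ᵥ u ∈ weightCone := by
  obtain ⟨h0, h1, h2, h3, h4, h5, h6, h7⟩ := hu
  fin_cases j <;>
    simp [weightCone, Mmat, dotProduct, Fin.sum_univ_four] <;>
    refine ⟨?_, ?_, ?_, ?_, ?_, ?_, ?_, ?_⟩ <;> linarith

lemma Mword_mulVec_mem_weightCone (w : Word) {u : Fin 4 → ℝ} (hu : u ∈ weightCone) :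
    Mword w *ᵥ u ∈ weightCone := by
  induction w with
  | nil => simpa [Mword] using hu
  | cons j w ih =>
    have := Mmat_mulVec_mem_weightCone j ih
    rwa [mulVec_mulVec] at this

section GammaEps

variable {ε : ℝ} {g g₁ g₂ : Fin 4 → ℝ}

lemma le_sq_of_mem_GammaEps (hε : 0 < ε) (hg : g ∈ GammaEps ε) : (ε / 2) ^ 2 ≤ g 3 ^ 2 := by
  obtain ⟨⟨h0, -⟩, ⟨h1, -⟩, ⟨h2, -⟩, h3, h4, h5, h6⟩ := hg
  rw [h3, kappa, Real.sq_sqrt (by positivity)]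
  have := mul_nonneg h0 h1
  have := mul_nonneg h1 h2
  have := mul_nonneg h2 h0
  rcases le_total (ε / 2) (g 0) with a | a <;> rcases le_total (ε / 2) (g 1) with b | b
  · nlinarith
  · nlinarith [mul_nonneg (sub_nonneg.2 a) (show 0 ≤ g 2 - ε / 2 by linarith)]
  · nlinarith [mul_nonneg (sub_nonneg.2 b) (show 0 ≤ g 2 - ε / 2 by linarith)]
  · nlinarith

lemma half_le_of_mem_GammaEps (hε : 0 < ε) (hg : g ∈ GammaEps ε) : ε / 2 ≤ g 3 := by
  have h := le_sq_of_mem_GammaEps hε hg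
  refine (abs_le_of_sq_le_sq' h ?_).2
  rw [hg.2.2.2.1]
  exact Real.sqrt_nonneg _

lemma GammaEps_subset_Gamma (hε : 0 < ε) : GammaEps ε ⊆ Gamma := fun _ hg =>
  ⟨hg.1.1, hg.2.1.1, hg.2.2.1.1, hg.2.2.2.1, (half_pos hε).trans_le (half_le_of_mem_GammaEps hε hg)⟩

lemma nonneg_of_mem_GammaEps (hε : 0 < ε) (hg : g ∈ GammaEps ε) (i : Fin 4) : 0 ≤ g i := by
  fin_cases i
  exacts [hg.1.1, hg.2.1.1, hg.2.2.1.1, (GammaEps_subset_Gamma hε hg).2.2.2.2.le]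

lemma le_of_mem_GammaEps (hε : 0 < ε) (hg : g ∈ GammaEps ε) (i : Fin 4) : g i ≤ 2 * ε⁻¹ := by
  have hs := sq_of_mem_Gamma (GammaEps_subset_Gamma hε hg)
  obtain ⟨⟨h0, h0'⟩, ⟨h1, h1'⟩, ⟨h2, h2'⟩, -⟩ := hg
  have he : 0 < ε⁻¹ := inv_pos.2 hε
  fin_cases i
  · change g 0 ≤ _; linarith
  · change g 1 ≤ _; linarith
  · change g 2 ≤ _; linarith
  · refine (abs_le_of_sq_le_sq' ?_ (by positivity)).2
    change g 3 ^ 2 ≤ _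
    nlinarith [mul_le_mul h1' h2' h2 he.le, mul_le_mul h2' h0' h0 he.le,
      mul_le_mul h0' h1' h1 he.le]

lemma abs_sub_le_rhoGamma (g₁ g₂ : Fin 4 → ℝ) (j : Fin 3) :
    |g₁ j.castSucc - g₂ j.castSucc| ≤ rhoGamma g₁ g₂ := by
  refine Real.abs_le_sqrt ?_
  have h0 := sq_nonneg (g₁ 0 - g₂ 0)
  have h1 := sq_nonneg (g₁ 1 - g₂ 1)
  have h2 := sq_nonneg (g₁ 2 - g₂ 2)
  fin_cases j
  · change (g₁ 0 - g₂ 0) ^ 2 ≤ _; linarith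
  · change (g₁ 1 - g₂ 1) ^ 2 ≤ _; linarith
  · change (g₁ 2 - g₂ 2) ^ 2 ≤ _; linarith

lemma abs_mul_sub_mul_le_add {a b x y A B X Y : ℝ} (hab : |a - b| ≤ A) (hb : 0 ≤ b) (hbB : b ≤ B)
    (hx : |x| ≤ X) (hxy : |x - y| ≤ Y) : |a * x - b * y| ≤ A * X + B * Y := by
  have hA : 0 ≤ A := (abs_nonneg _).trans hab
  have hB : 0 ≤ B := hb.trans hbB
  calc |a * x - b * y| = |(a - b) * x + b * (x - y)| := by ring_nf
    _ ≤ |(a - b) * x| + |b * (x - y)| := abs_add_le _ _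
    _ = |a - b| * |x| + b * |x - y| := by rw [abs_mul, abs_mul, abs_of_nonneg hb]
    _ ≤ A * X + B * Y := by gcongr

lemma abs_mul_sub_mul_le {a b c d K r : ℝ} (ha : |a - b| ≤ r) (hc : |c - d| ≤ r) (hc0 : 0 ≤ c)
    (hb0 : 0 ≤ b) (hcK : c ≤ K) (hbK : b ≤ K) : |a * c - b * d| ≤ 2 * K * r := by
  have := abs_mul_sub_mul_le_add ha hb0 hbK ((abs_of_nonneg hc0).trans_le hcK) hc
  linarith

lemma rhoGamma_nonneg (g₁ g₂ : Fin 4 → ℝ) : 0 ≤ rhoGamma g₁ g₂ := Real.sqrt_nonneg _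

lemma rhoGamma_comm (g₁ g₂ : Fin 4 → ℝ) : rhoGamma g₁ g₂ = rhoGamma g₂ g₁ := by
  unfold rhoGamma
  congr 1
  ring

lemma abs_sub_le_of_mem_GammaEps (hε : ε ∈ Set.Ioo (0 : ℝ) 1) (h₁ : g₁ ∈ GammaEps ε)
    (h₂ : g₂ ∈ GammaEps ε) (i : Fin 4) : |g₁ i - g₂ i| ≤ 6 * ε⁻¹ ^ 2 * rhoGamma g₁ g₂ := by
  have hr := rhoGamma_nonneg g₁ g₂
  have he : 1 ≤ ε⁻¹ := (one_le_inv₀ hε.1).2 hε.2.le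
  have hρ : ∀ j : Fin 3, |g₁ j.castSucc - g₂ j.castSucc| ≤ 6 * ε⁻¹ ^ 2 * rhoGamma g₁ g₂ :=
    fun j => (abs_sub_le_rhoGamma g₁ g₂ j).trans (le_mul_of_one_le_left hr (by nlinarith))
  induction i using Fin.lastCases with
  | cast j => exact hρ j
  | last =>
    change |g₁ 3 - g₂ 3| ≤ _
    have hk₁ := half_le_of_mem_GammaEps hε.1 h₁
    have hk₂ := half_le_of_mem_GammaEps hε.1 h₂
    have hs₁ := sq_of_mem_Gamma (GammaEps_subset_Gamma hε.1 h₁)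
    have hs₂ := sq_of_mem_Gamma (GammaEps_subset_Gamma hε.1 h₂)
    obtain ⟨⟨a0, a0'⟩, ⟨a1, a1'⟩, ⟨a2, a2'⟩, -⟩ := h₁
    obtain ⟨⟨b0, b0'⟩, ⟨b1, b1'⟩, ⟨b2, b2'⟩, -⟩ := h₂
    have d0 : |g₁ 0 - g₂ 0| ≤ _ := abs_sub_le_rhoGamma g₁ g₂ 0
    have d1 : |g₁ 1 - g₂ 1| ≤ _ := abs_sub_le_rhoGamma g₁ g₂ 1
    have d2 : |g₁ 2 - g₂ 2| ≤ _ := abs_sub_le_rhoGamma g₁ g₂ 2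
    have p12 := abs_le.1 (abs_mul_sub_mul_le d1 d2 a2 b1 a2' b1')
    have p20 := abs_le.1 (abs_mul_sub_mul_le d2 d0 a0 b2 a0' b2')
    have p01 := abs_le.1 (abs_mul_sub_mul_le d0 d1 a1 b0 a1' b0')
    have hprod : ε * |g₁ 3 - g₂ 3| ≤ 6 * ε⁻¹ * rhoGamma g₁ g₂ := by
      calc ε * |g₁ 3 - g₂ 3| ≤ (g₁ 3 + g₂ 3) * |g₁ 3 - g₂ 3| := by gcongr; linarith
        _ = |g₁ 3 ^ 2 - g₂ 3 ^ 2| := by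
            rw [sq_sub_sq, abs_mul, abs_of_nonneg (show 0 ≤ g₁ 3 + g₂ 3 by linarith [hε.1])]
        _ ≤ 6 * ε⁻¹ * rhoGamma g₁ g₂ := by
            rw [hs₁, hs₂, abs_le]
            constructor <;> linarith [p12.1, p12.2, p20.1, p20.2, p01.1, p01.2]
    calc |g₁ 3 - g₂ 3| = ε⁻¹ * (ε * |g₁ 3 - g₂ 3|) := (inv_mul_cancel_left₀ hε.1.ne' _).symm
      _ ≤ ε⁻¹ * (6 * ε⁻¹ * rhoGamma g₁ g₂) := by gcongr
      _ = 6 * ε⁻¹ ^ 2 * rhoGamma g₁ g₂ := by ring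

lemma dotProduct_le_of_abs_le {v u : Fin 4 → ℝ} {c : ℝ} (hv : ∀ i, |v i| ≤ c)
    (hu : ∀ i, 0 ≤ u i) : v ⬝ᵥ u ≤ c * ∑ i, u i := by
  rw [dotProduct, Finset.mul_sum]
  exact Finset.sum_le_sum fun i _ =>
    mul_le_mul_of_nonneg_right ((le_abs_self _).trans (hv i)) (hu i)

lemma nonneg_of_mem_weightCone {u : Fin 4 → ℝ} (hu : u ∈ weightCone) (i : Fin 4) : 0 ≤ u i := by
  obtain ⟨h0, h1, h2, h3, -⟩ := hu
  fin_cases i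
  exacts [h0, h1, h2, h3]

lemma sum_le_dotProduct (hε : 0 < ε) (hg : g ∈ GammaEps ε) {u : Fin 4 → ℝ} (hu : u ∈ weightCone) :
    ∑ i, u i ≤ 12 * ε⁻¹ * (g ⬝ᵥ u) := by
  have hk := half_le_of_mem_GammaEps hε hg
  obtain ⟨⟨a0, -⟩, ⟨a1, -⟩, ⟨a2, -⟩, -, h12, h20, h01⟩ := hg
  obtain ⟨h0, h1, h2, h3, h4, h5, h6, h7⟩ := hu
  have key : ε * (u 0 + u 1 + u 2 + u 3) ≤
      12 * (g 0 * u 0 + g 1 * u 1 + g 2 * u 2 + g 3 * u 3) := by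
    have hu3 : 0 ≤ g 3 * u 3 := mul_nonneg (by linarith) h3
    have p0 := mul_nonneg a0 h0
    have p1 := mul_nonneg a1 h1
    have p2 := mul_nonneg a2 h2
    have q0 := mul_le_mul_of_nonneg_left h4 hε.le
    have q1 := mul_le_mul_of_nonneg_left h5 hε.le
    have q2 := mul_le_mul_of_nonneg_left h6 hε.le
    have q3 := mul_le_mul_of_nonneg_left h7 hε.le
    have aux : ∀ a x : ℝ, 0 ≤ x → ε / 2 ≤ a → ε * x ≤ 2 * (a * x) := fun a x hx ha => by
      nlinarith [mul_le_mul_of_nonneg_right ha hx]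
    rcases le_total (ε / 2) (g 0) with a | a
    · have r0 := aux _ _ h0 a
      rcases le_total (ε / 2) (g 1) with b | b
      · have r1 := aux _ _ h1 b
        linarith
      · have r2 := aux (g 2) _ h2 (by linarith)
        linarith
    · have r1 := aux (g 1) _ h1 (by linarith)
      have r2 := aux (g 2) _ h2 (by linarith)
      linarith
  rw [dotProduct, Fin.sum_univ_four, Fin.sum_univ_four, mul_comm 12, mul_assoc,
    ← div_eq_inv_mul, le_div_iff₀' hε]
  exact key

lemma dotProduct_le_dotProduct (hε : 0 < ε) (h₁ : g₁ ∈ GammaEps ε) (h₂ : g₂ ∈ GammaEps ε)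
    {u : Fin 4 → ℝ} (hu : u ∈ weightCone) : g₁ ⬝ᵥ u ≤ 24 * ε⁻¹ ^ 2 * (g₂ ⬝ᵥ u) := by
  have he : 0 < ε⁻¹ := inv_pos.2 hε
  calc g₁ ⬝ᵥ u ≤ 2 * ε⁻¹ * ∑ i, u i :=
        dotProduct_le_of_abs_le (fun i => by
          rw [abs_of_nonneg (nonneg_of_mem_GammaEps hε h₁ i)]
          exact le_of_mem_GammaEps hε h₁ i) (nonneg_of_mem_weightCone hu)
    _ ≤ 2 * ε⁻¹ * (12 * ε⁻¹ * (g₂ ⬝ᵥ u)) := by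
        gcongr
        exact sum_le_dotProduct hε h₂ hu
    _ = 24 * ε⁻¹ ^ 2 * (g₂ ⬝ᵥ u) := by ring

lemma dotProduct_le_one_add_mul (hε : ε ∈ Set.Ioo (0 : ℝ) 1) (h₁ : g₁ ∈ GammaEps ε)
    (h₂ : g₂ ∈ GammaEps ε) {u : Fin 4 → ℝ} (hu : u ∈ weightCone) :
    g₁ ⬝ᵥ u ≤ (1 + 72 * ε⁻¹ ^ 3 * rhoGamma g₁ g₂) * (g₂ ⬝ᵥ u) := by
  have he : 0 < ε⁻¹ := inv_pos.2 hε.1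
  have hr := rhoGamma_nonneg g₁ g₂
  have h : (g₁ - g₂) ⬝ᵥ u ≤ 72 * ε⁻¹ ^ 3 * rhoGamma g₁ g₂ * (g₂ ⬝ᵥ u) := by
    calc (g₁ - g₂) ⬝ᵥ u ≤ 6 * ε⁻¹ ^ 2 * rhoGamma g₁ g₂ * ∑ i, u i :=
          dotProduct_le_of_abs_le (abs_sub_le_of_mem_GammaEps hε h₁ h₂)
            (nonneg_of_mem_weightCone hu)
      _ ≤ 6 * ε⁻¹ ^ 2 * rhoGamma g₁ g₂ * (12 * ε⁻¹ * (g₂ ⬝ᵥ u)) := by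
          gcongr
          exact sum_le_dotProduct hε.1 h₂ hu
      _ = 72 * ε⁻¹ ^ 3 * rhoGamma g₁ g₂ * (g₂ ⬝ᵥ u) := by ring
  rw [sub_dotProduct] at h
  linarith

end GammaEps

lemma HGamma_vecMul_rpow_le {g g' : Fin 4 → ℝ} (hg : g ∈ Gamma) (hg' : g' ∈ Gamma) (w : Word)
    {c c' : ℝ} (hc : 0 < c) (hc' : 0 < c')
    (h : ∀ u ∈ weightCone, g ⬝ᵥ u ≤ c * (g' ⬝ᵥ u))
    (h' : ∀ u ∈ weightCone, g' ⬝ᵥ u ≤ c' * (g ⬝ᵥ u)) :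
    HGamma (g' ᵥ* Mword w) ^ (1 / dAG) ≤ c * HGamma (g ᵥ* Mword w) ^ (1 / dAG) := by
  refine HGamma_rpow_le (vecMul_Mword_mem_Gamma hg w) (vecMul_Mword_mem_Gamma hg' w) hc hc'
    (fun x hx => ?_) fun x hx => ?_
  all_goals
    rw [← dotProduct_mulVec, ← dotProduct_mulVec]
    have := Mword_mulVec_mem_weightCone w (weight_mem_weightCone hx)
  · exact h _ this
  · exact h' _ this

lemma HGamma_rpow_le_smul {g : Fin 4 → ℝ} (hg : g ∈ Gamma) {s : ℝ} (hs : 0 < s) :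
    s * HGamma g ^ (1 / dAG) ≤ HGamma (s⁻¹ • g) ^ (1 / dAG) := by
  have := HGamma_rpow_le (smul_mem_Gamma hg (inv_pos.2 hs)) hg (inv_pos.2 hs) hs
    (fun x _ => by rw [smul_dotProduct, smul_eq_mul])
    (fun x _ => by rw [smul_dotProduct, smul_eq_mul, mul_inv_cancel_left₀ hs.ne'])
  rwa [← div_eq_inv_mul, le_div_iff₀' hs] at this

lemma abs_le_euclNorm4 (v : Fin 4 → ℝ) (i : Fin 4) : |v i| ≤ euclNorm4 v :=
  Real.abs_le_sqrt (Finset.single_le_sum (f := fun i => v i ^ 2) (fun _ _ => sq_nonneg _)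
    (Finset.mem_univ i))

lemma euclNorm4_le_sum (v : Fin 4 → ℝ) : euclNorm4 v ≤ ∑ i, |v i| := by
  refine Real.sqrt_le_iff.2 ⟨Finset.sum_nonneg fun _ _ => abs_nonneg _, ?_⟩
  simp_rw [← sq_abs (v _)]
  exact Finset.sum_sq_le_sq_sum_of_nonneg fun _ _ => abs_nonneg _

lemma abs_apply_le_opNorm4 (M : Matrix (Fin 4) (Fin 4) ℝ) (i j : Fin 4) :
    |M i j| ≤ opNorm4 M := by
  have hbdd : BddAbove {t : ℝ | ∃ v : Fin 4 → ℝ, euclNorm4 v ≤ 1 ∧ t = euclNorm4 (M.mulVec v)} := by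
    refine ⟨∑ i, ∑ j, |M i j|, ?_⟩
    rintro _ ⟨v, hv, rfl⟩
    refine (euclNorm4_le_sum _).trans (Finset.sum_le_sum fun i _ => ?_)
    refine (Finset.abs_sum_le_sum_abs (fun j => M i j * v j) Finset.univ).trans
      (Finset.sum_le_sum fun j _ => ?_)
    rw [abs_mul]
    exact mul_le_of_le_one_right (abs_nonneg _) ((abs_le_euclNorm4 v j).trans hv)
  have hcol : M *ᵥ Pi.single j 1 = M.col j := mulVec_single_one M j
  calc |M i j| ≤ euclNorm4 (M *ᵥ Pi.single j 1) := by
        rw [hcol]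
        exact abs_le_euclNorm4 (M.col j) i
    _ ≤ opNorm4 M := le_csSup hbdd ⟨Pi.single j 1, by simp [euclNorm4, Pi.single_apply], rfl⟩

lemma opNorm4_Mword_pos (w : Word) {g : Fin 4 → ℝ} (hg : g ∈ Gamma) : 0 < opNorm4 (Mword w) := by
  by_contra hc
  have hz : Mword w = 0 := by
    ext i j
    have := abs_apply_le_opNorm4 (Mword w) i j
    exact abs_nonpos_iff.1 (this.trans (not_lt.1 hc))
  have := (vecMul_Mword_mem_Gamma hg w).2.2.2.2
  simp [hz] at this

lemma abs_vecMul_le {M : Matrix (Fin 4) (Fin 4) ℝ} {v : Fin 4 → ℝ} {c : ℝ} (hv : ∀ i, |v i| ≤ c)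
    (j : Fin 4) : |(v ᵥ* M) j| ≤ 4 * c * opNorm4 M := by
  have hc : 0 ≤ c := (abs_nonneg _).trans (hv 0)
  calc |(v ᵥ* M) j| ≤ ∑ i, |v i * M i j| :=
        Finset.abs_sum_le_sum_abs (fun i => v i * M i j) Finset.univ
    _ ≤ ∑ _i : Fin 4, c * opNorm4 M := Finset.sum_le_sum fun i _ => by
        rw [abs_mul]
        exact mul_le_mul (hv i) (abs_apply_le_opNorm4 M i j) (abs_nonneg _) hc
    _ = 4 * c * opNorm4 M := by simp; ring

lemma rhoGamma_le_of_abs_le {g₁ g₂ : Fin 4 → ℝ} {c : ℝ} (h : ∀ i, |g₁ i - g₂ i| ≤ c) :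
    rhoGamma g₁ g₂ ≤ 3 * c := by
  have hc : 0 ≤ c := (abs_nonneg _).trans (h 0)
  have hs : ∀ i, (g₁ i - g₂ i) ^ 2 ≤ c ^ 2 := fun i => by
    rw [← sq_abs]
    exact pow_le_pow_left₀ (abs_nonneg _) (h i) 2
  refine Real.sqrt_le_iff.2 ⟨by positivity, ?_⟩
  nlinarith [hs 0, hs 1, hs 2, sq_nonneg c]

lemma HGamma_rpow_sub_le {ε : ℝ} (hε : ε ∈ Set.Ioo (0 : ℝ) 1) {g₀ g₁ g₂ : Fin 4 → ℝ}
    (h₀ : g₀ ∈ GammaEps ε) (h₁ : g₁ ∈ GammaEps ε) (h₂ : g₂ ∈ GammaEps ε) (w : Word) :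
    HGamma (g₁ ᵥ* Mword w) ^ (1 / dAG) - HGamma (g₂ ᵥ* Mword w) ^ (1 / dAG) ≤
      1728 * ε⁻¹ ^ 5 * rhoGamma g₁ g₂ * HGamma (g₀ ᵥ* Mword w) ^ (1 / dAG) := by
  have he : 0 < ε⁻¹ := inv_pos.2 hε.1
  have hr := rhoGamma_nonneg g₁ g₂
  have hΓ := GammaEps_subset_Gamma hε.1
  have ha := HGamma_vecMul_rpow_le (hΓ h₀) (hΓ h₂) w (by positivity) (by positivity)
    (fun u hu => dotProduct_le_dotProduct hε.1 h₀ h₂ hu)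
    (fun u hu => dotProduct_le_dotProduct hε.1 h₂ h₀ hu)
  have hb := HGamma_vecMul_rpow_le (hΓ h₂) (hΓ h₁) w
    (c := 1 + 72 * ε⁻¹ ^ 3 * rhoGamma g₂ g₁) (c' := 1 + 72 * ε⁻¹ ^ 3 * rhoGamma g₁ g₂)
    (by rw [rhoGamma_comm]; positivity) (by positivity)
    (fun u hu => dotProduct_le_one_add_mul hε h₂ h₁ hu)
    (fun u hu => dotProduct_le_one_add_mul hε h₁ h₂ hu)
  rw [rhoGamma_comm] at hb
  have hk : 0 ≤ 72 * ε⁻¹ ^ 3 * rhoGamma g₁ g₂ := by positivity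
  linarith [mul_le_mul_of_nonneg_left ha hk]

/-- Lipschitz estimate for the normalized map
`g ↦ ℋ_Γ(gM_w)^{1/d}·gM_w`. -/
theorem normalized_Mword_lipschitz :
    ∃ c₃ : ℝ, 0 < c₃ ∧ ∀ ε : ℝ, ε ∈ Set.Ioo (0:ℝ) 1 →
      ∀ g₀ ∈ GammaEps ε, ∀ g₁ ∈ GammaEps ε, ∀ g₂ ∈ GammaEps ε, ∀ w : Word,
        rhoGamma
          ((HGamma (Matrix.vecMul g₁ (Mword w)) ^ (1 / dAG)) • Matrix.vecMul g₁ (Mword w))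
          ((HGamma (Matrix.vecMul g₂ (Mword w)) ^ (1 / dAG)) • Matrix.vecMul g₂ (Mword w)) ≤
        c₃ * ε ^ (-(45 * dAG)) *
          HGamma ((opNorm4 (Mword w))⁻¹ • Matrix.vecMul g₀ (Mword w)) ^ (1 / dAG) *
          rhoGamma g₁ g₂ := by
  refine ⟨43200, by norm_num, fun ε hε g₀ h₀ g₁ h₁ g₂ h₂ w => ?_⟩
  have he : 1 ≤ ε⁻¹ := (one_le_inv₀ hε.1).2 hε.2.le
  have he0 : 0 < ε⁻¹ := inv_pos.2 hε.1
  have hr := rhoGamma_nonneg g₁ g₂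
  have hΓ := GammaEps_subset_Gamma hε.1
  have hN := opNorm4_Mword_pos w (hΓ h₀)
  have hscale := HGamma_rpow_le_smul (vecMul_Mword_mem_Gamma (hΓ h₀) w) hN
  have hd₁ := HGamma_rpow_sub_le hε h₀ h₁ h₂ w
  have hd₂ := HGamma_rpow_sub_le hε h₀ h₂ h₁ w
  rw [rhoGamma_comm] at hd₂
  have ha₂ := HGamma_vecMul_rpow_le (hΓ h₀) (hΓ h₂) w (by positivity) (by positivity)
    (fun u hu => dotProduct_le_dotProduct hε.1 h₀ h₂ hu)
    (fun u hu => dotProduct_le_dotProduct hε.1 h₂ h₀ hu)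
  have hv₁ : ∀ i, |(g₁ ᵥ* Mword w) i| ≤ 4 * (2 * ε⁻¹) * opNorm4 (Mword w) :=
    abs_vecMul_le fun i => by
      rw [abs_of_nonneg (nonneg_of_mem_GammaEps hε.1 h₁ i)]
      exact le_of_mem_GammaEps hε.1 h₁ i
  have hv₁₂ : ∀ i, |((g₁ - g₂) ᵥ* Mword w) i| ≤
      4 * (6 * ε⁻¹ ^ 2 * rhoGamma g₁ g₂) * opNorm4 (Mword w) :=
    abs_vecMul_le (abs_sub_le_of_mem_GammaEps hε h₁ h₂)
  have hpow : ε⁻¹ ^ 6 ≤ ε ^ (-(45 * dAG)) := by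
    rw [inv_pow, ← Real.rpow_natCast, ← Real.rpow_neg hε.1.le]
    exact Real.rpow_le_rpow_of_exponent_ge hε.1 hε.2.le (by
      push_cast
      linarith [one_le_dAG])
  set N := opNorm4 (Mword w)
  set r := rhoGamma g₁ g₂
  set a₀ := HGamma (g₀ ᵥ* Mword w) ^ (1 / dAG)
  set a₁ := HGamma (g₁ ᵥ* Mword w) ^ (1 / dAG)
  set a₂ := HGamma (g₂ ᵥ* Mword w) ^ (1 / dAG)
  have ha₀ : 0 ≤ a₀ := Real.rpow_nonneg ENNReal.toReal_nonneg _
  have ha₂' : 0 ≤ a₂ := Real.rpow_nonneg ENNReal.toReal_nonneg _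
  clear_value N r a₀ a₁ a₂
  have hd : |a₁ - a₂| ≤ 1728 * ε⁻¹ ^ 5 * r * a₀ := abs_sub_le_iff.2 ⟨hd₁, hd₂⟩
  have h46 : ε⁻¹ ^ 4 ≤ ε⁻¹ ^ 6 := pow_le_pow_right₀ he (by norm_num)
  have hcoord : ∀ i, |(a₁ • (g₁ ᵥ* Mword w)) i - (a₂ • (g₂ ᵥ* Mword w)) i| ≤
      14400 * ε⁻¹ ^ 6 * (N * a₀) * r := fun i => by
    have hx : |(g₁ ᵥ* Mword w) i - (g₂ ᵥ* Mword w) i| ≤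
        4 * (6 * ε⁻¹ ^ 2 * r) * N := by
      rw [← Pi.sub_apply, ← sub_vecMul]
      exact hv₁₂ i
    calc |(a₁ • (g₁ ᵥ* Mword w)) i - (a₂ • (g₂ ᵥ* Mword w)) i|
        ≤ 1728 * ε⁻¹ ^ 5 * r * a₀ * (4 * (2 * ε⁻¹) * N) +
            24 * ε⁻¹ ^ 2 * a₀ * (4 * (6 * ε⁻¹ ^ 2 * r) * N) :=
          abs_mul_sub_mul_le_add hd ha₂' ha₂ (hv₁ i) hx
      _ = (13824 * ε⁻¹ ^ 6 + 576 * ε⁻¹ ^ 4) * (N * a₀) * r := by ring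
      _ ≤ 14400 * ε⁻¹ ^ 6 * (N * a₀) * r := by
          gcongr
          linarith
  calc rhoGamma (a₁ • (g₁ ᵥ* Mword w)) (a₂ • (g₂ ᵥ* Mword w))
      ≤ 3 * (14400 * ε⁻¹ ^ 6 * (N * a₀) * r) := rhoGamma_le_of_abs_le hcoord
    _ = 43200 * ε⁻¹ ^ 6 * (N * a₀) * r := by ring
    _ ≤ 43200 * ε ^ (-(45 * dAG)) *
          HGamma (N⁻¹ • (g₀ ᵥ* Mword w)) ^ (1 / dAG) * r := by
        gcongr
        exact mul_nonneg (by norm_num) (Real.rpow_nonneg hε.1.le _)
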